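/- arXiv:1412.7217 — 3 statements merged into one kernel-verified Lean document; each statement's English description precedes it below -/
import Mathlib

section
/- Let b^∞_0,…,b^∞_{d_x−1} be an integral basis over K[1/x] and define the matrix G^∞ ∈ M_{d_x}(K(x)) by d b^∞_j = Σ_{i=0}^{d_x−1} G^∞_{i+1,j+1} b^∞_i dx in Ω¹_{L/K}. Then every entry of G^∞ has valuation at infinity at least 1; that is, writing an entry as a quotient g/h of polynomials in K[x], one has deg h ≥ deg g + 1. Equivalently, the matrix of 1-forms G^∞ dx has at most a simple pole at x = ∞. -/
open Polynomial

section core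
open IsDedekindDomain WithZero

variable {K L B : Type*} [Field K] [CharZero K] [Field L] [Algebra K L] [CommRing B]
  [IsDedekindDomain B] [Algebra K B] [Algebra B L] [IsFractionRing B L] [IsScalarTower K B L]

lemma core_nat (K : Type*) {L B : Type*} [Field K] [CharZero K] [Field L] [CommRing B]
    [IsDedekindDomain B] [Algebra K B] [Algebra B L] [IsFractionRing B L]
    (v : HeightOneSpectrum B) {e : ℕ} (he : e ≠ 0) :
    v.valuation L (e : L) = 1 := by
  have h1 : v.valuation L (algebraMap B L (e : B)) ≤ 1 := v.valuation_le_one _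
  have h2 : v.valuation L (algebraMap B L (algebraMap K B (e : K)⁻¹)) ≤ 1 := v.valuation_le_one _
  have h3 : (algebraMap B L (e : B)) * (algebraMap B L (algebraMap K B (e : K)⁻¹)) = 1 := by
    rw [← map_mul]
    have : (e : B) = algebraMap K B (e : K) := by simp
    rw [this, ← map_mul, mul_inv_cancel₀ (by exact_mod_cast he)]; simp
  have h4 := congrArg (v.valuation L) h3
  rw [map_mul, map_one] at h4
  have h5 : v.valuation L (algebraMap B L (e : B)) = 1 := by
    refine le_antisymm h1 ?_
    rw [← h4]
    exact mul_le_of_le_one_right' h2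
  simpa using h5

lemma core_A (v : HeightOneSpectrum B) (δ : Derivation K L L) (t : B) (ht0 : t ≠ 0)
    (ht : t ∈ v.asIdeal) (hδ : δ (algebraMap B L t) = algebraMap B L t)
    (C : WithZero (Multiplicative ℤ)) (hC : 1 ≤ C)
    (h : ∀ γ : B, γ ∉ v.asIdeal → v.valuation L (δ (algebraMap B L γ)) ≤ C) (β : B) :
    v.valuation L (δ (algebraMap B L β)) ≤ C * v.valuation L (algebraMap B L β) := by
  by_cases hβ : β = 0
  · simp [hβ]
  set V := v.valuation L
  have hinj := FaithfulSMul.algebraMap_injective B L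
  have hβL : algebraMap B L β ≠ 0 := by simpa using hβ
  have htL : algebraMap B L t ≠ 0 := by simpa using ht0
  have hVb : V (algebraMap B L β) ≠ 0 := by simpa using hβL
  -- exponents
  have key : ∀ b : B, b ≠ 0 → ∃ k : ℕ, V (algebraMap B L b) = exp (-(k : ℤ)) := by
    intro b hb
    exact ⟨_, (v.valuation_of_algebraMap b).trans (v.intValuation_if_neg hb)⟩
  obtain ⟨e, he⟩ := key t ht0
  obtain ⟨k, hk⟩ := key β hβ
  have he0 : e ≠ 0 := by
    rintro rfl
    have := (v.valuation_lt_one_iff_mem (K := L) t).2 ht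
    change V (algebraMap B L t) < 1 at this
    rw [he] at this; simp at this
  have hV : V (algebraMap B L β ^ e) = V (algebraMap B L t ^ k) := by
    rw [map_pow, map_pow, he, hk, ← exp_nsmul, ← exp_nsmul]
    congr 1; simp [mul_comm]
  have hle : V (algebraMap B L β ^ e / algebraMap B L t ^ k) ≤ 1 := by
    rw [map_div₀, hV, div_self]; simp [htL]
  obtain ⟨γ', γ, hγ⟩ := v.exists_primeCompl_mul_eq_of_integer (K := L) _ hle
  have hγV : V (algebraMap B L γ) = 1 := v.valuation_eq_one_iff_notMem.2 γ.2
  have hγ'V : V (algebraMap B L γ') = 1 := by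
    rw [← hγ, map_mul, hγV, map_div₀, hV, div_self (by simp [htL]), one_mul]
  have hγ' : γ' ∉ v.asIdeal := v.valuation_eq_one_iff_notMem.1 hγ'V
  have heq : algebraMap B L β ^ e * algebraMap B L γ = algebraMap B L γ' * algebraMap B L t ^ k := by
    rw [← hγ]
    field_simp
  have hd := congrArg δ heq
  have htk : δ (algebraMap B L t ^ k) = (k : L) * algebraMap B L t ^ k := by
    rw [Derivation.leibniz_pow, hδ]
    rcases k with _ | k
    · simp
    · simp [pow_succ]
  obtain ⟨e', rfl⟩ : ∃ e', e = e' + 1 := ⟨e - 1, by omega⟩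
  rw [Derivation.leibniz, Derivation.leibniz, htk, Derivation.leibniz_pow] at hd
  simp only [smul_eq_mul, nsmul_eq_mul, Nat.add_sub_cancel] at hd
  have hd2 : algebraMap B L γ * ((e' + 1 : ℕ) : L) * algebraMap B L β ^ e' * δ (algebraMap B L β)
      = (algebraMap B L γ' * ((k : L) * algebraMap B L t ^ k)
        + algebraMap B L t ^ k * δ (algebraMap B L γ'))
        - algebraMap B L β ^ (e' + 1) * δ (algebraMap B L γ) := by
    rw [← hd]; ring
  have hVd := congrArg V hd2
  have hnat : V ((e' + 1 : ℕ) : L) = 1 := core_nat K v (by omega)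
  have hk1 : V (k : L) ≤ 1 := by
    have := v.valuation_le_one (K := L) (k : B)
    simpa using this
  rw [map_mul, map_mul, map_mul, hγV, hnat, one_mul, one_mul, map_pow] at hVd
  have hb : V (algebraMap B L β) ^ e' * V (δ (algebraMap B L β))
      ≤ C * V (algebraMap B L β) ^ (e' + 1) := by
    rw [hVd]
    refine (V.map_sub _ _).trans (max_le ((V.map_add _ _).trans (max_le ?_ ?_)) ?_)
    · rw [map_mul, map_mul, hγ'V, one_mul, ← hV, map_pow]
      exact mul_le_mul' (hk1.trans hC) le_rfl
    · rw [map_mul, ← hV, map_pow, mul_comm]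
      exact mul_le_mul' (h _ hγ') le_rfl
    · rw [map_mul, map_pow, mul_comm]
      exact mul_le_mul' (h _ γ.2) le_rfl
  rw [pow_succ, mul_left_comm] at hb
  exact le_of_mul_le_mul_left hb (pow_pos (zero_lt_iff.2 hVb) _)

lemma core_step (v : HeightOneSpectrum B) (δ : Derivation K L L)
    (C : WithZero (Multiplicative ℤ))
    (h : ∀ β : B, v.valuation L (δ (algebraMap B L β)) ≤ C * v.valuation L (algebraMap B L β))
    (γ : B) (P : K[X]) (hP : aeval γ P ∈ v.asIdeal) (hP' : aeval γ (derivative P) ∉ v.asIdeal) :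
    v.valuation L (δ (algebraMap B L γ)) ≤ C * exp (-1 : ℤ) := by
  have h1 := h (aeval γ P)
  rw [← aeval_algebraMap_apply, Derivation.map_aeval, smul_eq_mul, map_mul,
    aeval_algebraMap_apply, v.valuation_eq_one_iff_notMem.2 hP', one_mul,
    aeval_algebraMap_apply] at h1
  refine h1.trans (mul_le_mul' le_rfl ?_)
  rw [v.valuation_of_algebraMap]
  have := (v.intValuation_le_pow_iff_mem (aeval γ P) 1).2 (by simpa using hP)
  simpa using this

lemma core_final (v : HeightOneSpectrum B) (δ : Derivation K L L) (t : B) (ht0 : t ≠ 0)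
    (ht : t ∈ v.asIdeal) (hδ : δ (algebraMap B L t) = algebraMap B L t)
    (hres : ∀ γ : B, ∃ P : K[X], aeval γ P ∈ v.asIdeal ∧ aeval γ (derivative P) ∉ v.asIdeal)
    (d : B) (hd : d ≠ 0)
    (hdB : ∀ β : B, ∃ g : B, algebraMap B L d * δ (algebraMap B L β) = algebraMap B L g) (β : B) :
    v.valuation L (δ (algebraMap B L β)) ≤ 1 := by
  have main : ∀ n : ℕ, (∀ γ : B, γ ∉ v.asIdeal →
      v.valuation L (δ (algebraMap B L γ)) ≤ exp (n : ℤ)) →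
      ∀ γ : B, γ ∉ v.asIdeal → v.valuation L (δ (algebraMap B L γ)) ≤ exp (0 : ℤ) := by
    intro n
    induction n with
    | zero => intro h; simpa using h
    | succ n ih =>
      intro h
      apply ih
      intro γ _
      obtain ⟨P, hP, hP'⟩ := hres γ
      have := core_step v δ _ (core_A v δ t ht0 ht hδ (exp ((n + 1 : ℕ) : ℤ))
        (by rw [← exp_zero, exp_le_exp]; positivity) h) γ P hP hP'
      rw [← exp_add] at this
      simpa using this
  have hdL : algebraMap B L d ≠ 0 := by simpa using hd
  obtain ⟨k, hk⟩ : ∃ k : ℕ, v.valuation L (algebraMap B L d) = exp (-(k : ℤ)) :=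
    ⟨_, (v.valuation_of_algebraMap d).trans (v.intValuation_if_neg hd)⟩
  have h0 := main k (by
    intro γ _
    obtain ⟨g, hg⟩ := hdB γ
    have h1 : v.valuation L (algebraMap B L g) ≤ 1 := v.valuation_le_one g
    rw [← hg, map_mul, hk, exp_neg] at h1
    rwa [inv_mul_le_iff₀ (by simp), mul_one] at h1)
  have := core_A v δ t ht0 ht hδ 1 le_rfl (by simpa using h0) β
  rw [one_mul] at this
  exact this.trans (v.valuation_le_one _)

end core

lemma exists_der (K F L : Type*) [Field K] [CharZero K] [Field F] [Field L] [Algebra K[X] F]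
    [IsFractionRing K[X] F] [Algebra F L] [Algebra K[X] L] [IsScalarTower K[X] F L]
    [FiniteDimensional F L] [Algebra K L] [IsScalarTower K K[X] L] :
    ∃ δ : Derivation K L L, δ (algebraMap K[X] L X) = algebraMap K[X] L X := by
  have : CharZero F := charZero_of_injective_algebraMap (R := K[X])
    (IsFractionRing.injective K[X] F)
  have : Algebra.FormallyEtale K[X] F := Algebra.FormallyEtale.of_isLocalization (nonZeroDivisors K[X])
  have : Algebra.FormallyEtale F L := Algebra.FormallyEtale.of_isSeparable F L
  have : Algebra.FormallyEtale K[X] L := Algebra.FormallyEtale.comp K[X] F L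
  let ℓ : Ω[L⁄K] →ₗ[L] L :=
    (TensorProduct.AlgebraTensorModule.rid K[X] L L).toLinearMap ∘ₗ
    (TensorProduct.AlgebraTensorModule.map LinearMap.id
      (KaehlerDifferential.polynomialEquiv K).toLinearMap) ∘ₗ
    (KaehlerDifferential.tensorKaehlerEquivOfFormallyEtale K K[X] L).symm.toLinearMap
  refine ⟨(algebraMap K[X] L X) • ℓ.compDer (KaehlerDifferential.D K L), ?_⟩
  have h1 : ℓ (KaehlerDifferential.D K L (algebraMap K[X] L X)) = 1 := by
    simp only [ℓ, LinearMap.comp_apply, LinearEquiv.coe_coe]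
    rw [KaehlerDifferential.tensorKaehlerEquivOfFormallyEtale_symm_D_algebraMap]
    simp
  change algebraMap K[X] L X * ℓ (KaehlerDifferential.D K L (algebraMap K[X] L X)) = _
  rw [h1, mul_one]

lemma hres_aux {K B : Type*} [Field K] [CharZero K] [CommRing B] [Algebra K B] [Algebra K[X] B]
    [IsScalarTower K K[X] B] [Algebra.IsIntegral K[X] B] (v : Ideal B) [hv : v.IsMaximal]
    (ht : algebraMap K[X] B X ∈ v) (γ : B) :
    ∃ P : K[X], aeval γ P ∈ v ∧ aeval γ (derivative P) ∉ v := by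
  letI : Field (B ⧸ v) := Ideal.Quotient.field v
  have hcomp : (Ideal.Quotient.mk v).comp (algebraMap K[X] B) =
      (algebraMap K (B ⧸ v)).comp (constantCoeff) := by
    refine Polynomial.ringHom_ext ?_ ?_
    · intro a
      have : algebraMap K[X] B (C a) = algebraMap K B a :=
        (IsScalarTower.algebraMap_apply K K[X] B a).symm
      simp only [RingHom.comp_apply, this, constantCoeff_apply, coeff_C_zero]
      rfl
    · simpa using Ideal.Quotient.eq_zero_iff_mem.2 ht
  have hint : IsIntegral K (Ideal.Quotient.mk v γ) := by
    obtain ⟨Q, hQ, h0⟩ := Algebra.IsIntegral.isIntegral (R := K[X]) γ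
    refine ⟨Q.map constantCoeff, hQ.map _, ?_⟩
    rw [eval₂_map, ← hcomp, ← hom_eval₂, h0, map_zero]
  have hq : ∀ P : K[X], aeval (Ideal.Quotient.mk v γ) P = Ideal.Quotient.mk v (aeval γ P) := by
    intro P
    exact aeval_algHom_apply (Ideal.Quotient.mkₐ K v) γ P
  refine ⟨minpoly K (Ideal.Quotient.mk v γ), ?_, ?_⟩
  · rw [← Ideal.Quotient.eq_zero_iff_mem, ← hq, minpoly.aeval]
  · rw [← Ideal.Quotient.eq_zero_iff_mem, ← hq]
    exact (minpoly.irreducible hint).separable.aeval_derivative_ne_zero (minpoly.aeval _ _)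

set_option maxHeartbeats 2000000 in
lemma main2 (K F L : Type*) [Field K] [CharZero K] [Field F] [Field L] [Algebra K[X] F]
    [IsFractionRing K[X] F] [Algebra F L] [Algebra K[X] L] [IsScalarTower K[X] F L]
    [FiniteDimensional F L] [Algebra K L] [IsScalarTower K K[X] L]
    (δ : Derivation K L L) (hδ : δ (algebraMap K[X] L X) = algebraMap K[X] L X)
    (n : ℕ) (b : Fin n → L) (hli : LinearIndependent F b)
    (hb : ∀ z : L, (∃ c : Fin n → K[X], z = ∑ i, algebraMap K[X] L (c i) * b i) ↔
      IsIntegral K[X] z)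
    (M : Fin n → Fin n → F) (hM : ∀ j, δ (b j) = ∑ i, algebraMap F L (M i j) * b i)
    (i j : Fin n) :
    ∃ p q : K[X], q.coeff 0 ≠ 0 ∧ algebraMap K[X] F q * M i j = algebraMap K[X] F p := by
  have : CharZero F := charZero_of_injective_algebraMap (R := K[X])
    (IsFractionRing.injective K[X] F)
  have hinjF := IsFractionRing.injective K[X] F
  have hinjL : Function.Injective (algebraMap K[X] L) := by
    rw [IsScalarTower.algebraMap_eq K[X] F L]
    exact (algebraMap F L).injective.comp hinjF
  let B := integralClosure K[X] L
  have : IsDedekindDomain B := integralClosure.isDedekindDomain K[X] F L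
  have : IsFractionRing B L := integralClosure.isFractionRing_of_finite_extension F L
  have : Algebra.IsIntegral K[X] B := inferInstance
  have hmapB : ∀ p : K[X], algebraMap B L (algebraMap K[X] B p) = algebraMap K[X] L p := fun p =>
    (IsScalarTower.algebraMap_apply K[X] B L p).symm
  have hneB : ∀ p : K[X], p ≠ 0 → algebraMap K[X] B p ≠ 0 := by
    intro p hp h
    have h2 := hmapB p
    rw [h, map_zero] at h2
    exact hp (hinjL (h2.symm.trans (map_zero _).symm))
  -- derivation on polynomials
  have hpoly : ∀ p : K[X], δ (algebraMap K[X] L p) = algebraMap K[X] L (X * derivative p) := by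
    intro p
    have h1 : ∀ p : K[X], algebraMap K[X] L p = aeval (algebraMap K[X] L X) p := by
      intro p
      rw [aeval_algebraMap_apply, aeval_X_left_apply]
    rw [h1 p, Derivation.map_aeval, hδ, smul_eq_mul, map_mul, ← h1, mul_comm]
  obtain ⟨⟨d, hd⟩, hdM⟩ := IsLocalization.exist_integer_multiples_of_finite (nonZeroDivisors K[X])
    (fun ij : Fin n × Fin n => M ij.1 ij.2)
  have hd0 : d ≠ 0 := nonZeroDivisors.ne_zero hd
  choose N hN using hdM
  simp only [Algebra.smul_def] at hN
  have hbint : ∀ i, IsIntegral K[X] (b i) := fun i =>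
    (hb _).1 ⟨fun k => if k = i then 1 else 0, by simp⟩
  have hdb : ∀ j, algebraMap K[X] L d * δ (b j) = ∑ i, algebraMap K[X] L (N (i, j)) * b i := by
    intro j
    rw [hM, Finset.mul_sum]
    refine Finset.sum_congr rfl fun i _ => ?_
    rw [IsScalarTower.algebraMap_apply K[X] F L, IsScalarTower.algebraMap_apply K[X] F L, hN,
      map_mul, mul_assoc]
  have hint : ∀ j, IsIntegral K[X] (algebraMap K[X] L d * δ (b j)) := fun j =>
    (hb _).1 ⟨_, hdb j⟩
  have hdB : ∀ β : B, ∃ g : B,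
      algebraMap B L (algebraMap K[X] B d) * δ (algebraMap B L β) = algebraMap B L g := by
    intro β
    rw [hmapB]
    suffices h : IsIntegral K[X] (algebraMap K[X] L d * δ (β : L)) from ⟨⟨_, h⟩, rfl⟩
    obtain ⟨c, hc⟩ := (hb _).2 β.2
    rw [hc, map_sum, Finset.mul_sum]
    refine IsIntegral.sum _ fun i _ => ?_
    rw [Derivation.leibniz, hpoly, smul_eq_mul, smul_eq_mul, mul_add]
    refine IsIntegral.add ?_ ?_
    · rw [mul_left_comm]
      exact isIntegral_algebraMap.mul (hint i)
    · exact isIntegral_algebraMap.mul ((hbint i).mul isIntegral_algebraMap)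
  -- split the denominator
  obtain ⟨q, hdq, hq⟩ := exists_eq_pow_rootMultiplicity_mul_and_not_dvd d hd0 0
  set k := rootMultiplicity 0 d
  rw [C_0, sub_zero] at hdq hq
  rw [X_dvd_iff] at hq
  have hz : IsIntegral K[X] (algebraMap K[X] L q * δ (b j)) := by
    have hall : ∀ v : IsDedekindDomain.HeightOneSpectrum B,
        v.valuation L (algebraMap K[X] L q * δ (b j)) ≤ 1 := by
      intro v
      have hle : ∀ z : L, IsIntegral K[X] z → v.valuation L z ≤ 1 := fun z hz =>
        v.valuation_le_one (⟨z, hz⟩ : B)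
      by_cases ht : algebraMap K[X] B X ∈ v.asIdeal
      · have hmax := v.isMaximal
        have h1 := core_final (K := K) v δ (algebraMap K[X] B X)
          (hneB X X_ne_zero) ht (by rw [hmapB]; exact hδ) (hres_aux v.asIdeal ht)
          (algebraMap K[X] B d) (hneB d hd0)
          hdB ⟨b j, hbint j⟩
        rw [map_mul]
        exact mul_le_one' (hle _ isIntegral_algebraMap) h1
      · have h1 : v.valuation L (algebraMap K[X] L X) = 1 := by
          rw [← hmapB]
          exact v.valuation_eq_one_iff_notMem.2 ht
        have h2 := hle _ (hint j)
        rw [hdq, RingHom.map_mul, RingHom.map_pow, mul_assoc, Valuation.map_mul, Valuation.map_pow, h1,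
          one_pow, one_mul] at h2
        exact h2
    obtain ⟨g, hg⟩ := IsDedekindDomain.HeightOneSpectrum.mem_integers_of_valuation_le_one L _ hall
    rw [← hg]
    exact g.2
  obtain ⟨c, hc⟩ := (hb _).2 hz
  refine ⟨c i, q, hq, ?_⟩
  rw [hM, Finset.mul_sum] at hc
  have hsum : ∑ i, (algebraMap K[X] F q * M i j - algebraMap K[X] F (c i)) • b i = 0 := by
    have h1 : ∀ i, (algebraMap K[X] F q * M i j - algebraMap K[X] F (c i)) • b i =
        algebraMap K[X] L q * (algebraMap F L (M i j) * b i) - algebraMap K[X] L (c i) * b i := by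
      intro i
      rw [Algebra.smul_def, map_sub, map_mul, ← IsScalarTower.algebraMap_apply,
        ← IsScalarTower.algebraMap_apply]
      ring
    rw [Finset.sum_congr rfl fun i _ => h1 i, Finset.sum_sub_distrib, hc, sub_self]
  exact sub_eq_zero.1 (Fintype.linearIndependent_iff.1 hli _ hsum i)

lemma refl_aux {K : Type*} [Field K] (N : ℕ) (r : K[X]) (hr : r.natDegree ≤ N) :
    aeval ((RatFunc.X : RatFunc K)⁻¹) r * RatFunc.X ^ N =
      algebraMap K[X] (RatFunc K) (reflect N r) := by
  have hX : (RatFunc.X : RatFunc K) ≠ 0 := RatFunc.X_ne_zero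
  let _ : Invertible (RatFunc.X : RatFunc K)⁻¹ := invertibleOfNonzero (inv_ne_zero hX)
  have := eval₂_reflect_mul_pow (algebraMap K (RatFunc K)) (RatFunc.X : RatFunc K)⁻¹ N r hr
  rw [invOf_eq_inv, inv_inv] at this
  rw [aeval_def, ← this, mul_assoc, ← mul_pow, inv_mul_cancel₀ hX, one_pow, mul_one]
  rw [← RatFunc.algebraMap_X, ← aeval_def, aeval_algebraMap_apply, aeval_X_left_apply]

lemma deg_aux {K : Type*} [Field K] (f : RatFunc K) (p q : K[X]) (hq : q.coeff 0 ≠ 0)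
    (h : aeval ((RatFunc.X : RatFunc K)⁻¹) q * (RatFunc.X * f) =
      aeval ((RatFunc.X : RatFunc K)⁻¹) p) :
    ∃ g h : K[X], h ≠ 0 ∧ f = algebraMap K[X] (RatFunc K) g / algebraMap K[X] (RatFunc K) h ∧
      g.degree < h.degree := by
  set N := max p.natDegree q.natDegree with hN
  have hX : (RatFunc.X : RatFunc K) ≠ 0 := RatFunc.X_ne_zero
  have hr : ∀ r : K[X], r.natDegree ≤ N → aeval ((RatFunc.X : RatFunc K)⁻¹) r * RatFunc.X ^ N =
      algebraMap K[X] (RatFunc K) (reflect N r) := by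
    exact fun r hr => refl_aux N r hr
  have hcoeff : (reflect N q).coeff N = q.coeff 0 := by simp [coeff_reflect]
  have hq0 : reflect N q ≠ 0 := by
    intro h0; rw [h0] at hcoeff; exact hq (by simpa using hcoeff.symm)
  refine ⟨reflect N p, X * reflect N q, mul_ne_zero X_ne_zero hq0, ?_, ?_⟩
  · rw [eq_div_iff (by simpa using ⟨hX, fun h => hq0 (by simp [h])⟩), map_mul, ← hr p (le_max_left _ _),
      ← hr q (le_max_right _ _), ← h, RatFunc.algebraMap_X]
    ring
  · have h1 : (reflect N p).degree ≤ N :=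
      degree_le_of_natDegree_le (natDegree_reflect_le.trans (by simp [hN]))
    have h2 : ((N + 1 : ℕ) : WithBot ℕ) ≤ (X * reflect N q).degree :=
      le_degree_of_ne_zero (by rw [coeff_X_mul, hcoeff]; exact hq)
    exact lt_of_le_of_lt h1 (lt_of_lt_of_le (by exact_mod_cast Nat.lt_succ_self N) h2)

lemma main3 {K F L : Type*} [Field K] [CharZero K] [Field F] [Field L] [Algebra F L]
    [FiniteDimensional F L] [Algebra K L] (φ : K[X] →+* F) (hφ : Function.Injective φ)
    (hsurj : ∀ z : F, ∃ p q : K[X], q ≠ 0 ∧ z * φ q = φ p)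
    (hK : ∀ a, algebraMap K L a = algebraMap F L (φ (C a)))
    (n : ℕ) (b : Fin n → L) (hli : LinearIndependent F b)
    (hb : ∀ z : L, (∃ c : Fin n → K[X], z = ∑ i, algebraMap F L (φ (c i)) * b i) ↔
      ((algebraMap F L).comp φ).IsIntegralElem z)
    (x : F) (hx : x = (φ X)⁻¹)
    (G : Fin n → Fin n → F)
    (hG : ∀ j, (KaehlerDifferential.D K L) (b j) =
      ∑ i, (algebraMap F L (G i j) * b i) • (KaehlerDifferential.D K L) (algebraMap F L x))
    (i j : Fin n) :
    ∃ p q : K[X], q.coeff 0 ≠ 0 ∧ φ q * (x * G i j) = φ p := by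
  letI : Algebra K[X] F := φ.toAlgebra
  letI : Algebra K[X] L := ((algebraMap F L).comp φ).toAlgebra
  have : IsScalarTower K[X] F L := IsScalarTower.of_algebraMap_eq' rfl
  have : IsScalarTower K K[X] L := IsScalarTower.of_algebraMap_eq' (RingHom.ext hK)
  have hne : ∀ q : K[X], q ≠ 0 → φ q ≠ 0 := fun q hq h => hq (hφ (h.trans (map_zero φ).symm))
  have : IsFractionRing K[X] F :=
    { map_units := fun y => (hne y (nonZeroDivisors.ne_zero y.2)).isUnit
      surj := fun z => by
        obtain ⟨p, q, hq, h⟩ := hsurj z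
        exact ⟨⟨p, q, mem_nonZeroDivisors_of_ne_zero hq⟩, h⟩
      exists_of_eq := fun {a c} h => ⟨1, by rw [hφ h]⟩ }
  obtain ⟨δ, hδ⟩ := exists_der K F L
  have hδx : δ (algebraMap F L x) = - algebraMap F L x := by
    have h1 : algebraMap F L x = (algebraMap K[X] L X)⁻¹ := by
      rw [hx, map_inv₀]; rfl
    have h2 : algebraMap K[X] L X ≠ 0 := by
      have : algebraMap F L (φ X) ≠ 0 := by simpa using hne X X_ne_zero
      exact this
    rw [h1, Derivation.leibniz_inv, hδ, smul_eq_mul]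
    field_simp
  have hM : ∀ j, δ (b j) = ∑ i, algebraMap F L (-(x * G i j)) * b i := by
    intro j
    have h := congrArg δ.liftKaehlerDifferential (hG j)
    simp only [map_sum, map_smul, Derivation.liftKaehlerDifferential_comp_D, hδx] at h
    rw [h]
    refine Finset.sum_congr rfl fun i _ => ?_
    rw [smul_eq_mul, map_neg, map_mul]; ring
  obtain ⟨p, q, hq, h⟩ := main2 K F L δ hδ n b hli hb (fun i j => -(x * G i j)) hM i j
  refine ⟨-p, q, hq, ?_⟩
  rw [map_neg]
  change φ q * -(x * G i j) = φ p at h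
  rw [← h]; ring

/-- **The connection matrix `G^∞` has at most a simple pole at `x = ∞`**
(Proposition 2.5 of the paper, part at infinity).  Setup: `K` a field of characteristic
zero, `Q ∈ K[x][y]` monic in `y` of degree `d_x ≥ 1` and irreducible over `K(x)`,
`L = K(x)[y]/(Q)` (presented as a field `L` with a generating root `y` of `Q`), and
`b^∞ = (b 0, …, b (d_x - 1))` an integral basis for `L` over `K[1/x]` (i.e. over the image
of `K[x] → K(x)`, `x ↦ 1/x`), and `G^∞ = G` the matrix with entries in `K(x)` defined by
`d (b j) = ∑ i, G i j • b i • dx` in `Ω¹_{L/K}`.  Conclusion: every entry of `G` has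
valuation at infinity at least `1`: it can be written as `g / h` with
`deg g < deg h`, i.e. `deg h ≥ deg g + 1`. -/
theorem connection_matrix_simple_pole_at_infinity {K L : Type*} [Field K] [CharZero K]
    [Field L] [Algebra (RatFunc K) L] [Algebra K L] [IsScalarTower K (RatFunc K) L]
    (dx : ℕ) (hdx : 1 ≤ dx)
    (Q : Polynomial (Polynomial K)) (hQM : Q.Monic) (hQdeg : Q.natDegree = dx)
    (hQirr : Irreducible (Q.map (algebraMap (Polynomial K) (RatFunc K))))
    (y : L) (hy : Polynomial.aeval y (Q.map (algebraMap (Polynomial K) (RatFunc K))) = 0)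
    (hgen : Algebra.adjoin (RatFunc K) {y} = ⊤)
    (b : Fin dx → L)
    (hb_li : LinearIndependent (RatFunc K) b)
    (hb_span : Submodule.span (RatFunc K) (Set.range b) = ⊤)
    (hb_int : ∀ z : L,
      (∃ c : Fin dx → Polynomial K,
          z = ∑ i, algebraMap (RatFunc K) L
            (Polynomial.aeval ((RatFunc.X : RatFunc K)⁻¹) (c i)) * b i)
        ↔ ((algebraMap (RatFunc K) L).comp
            (Polynomial.aeval ((RatFunc.X : RatFunc K)⁻¹) :
              Polynomial K →ₐ[K] RatFunc K).toRingHom).IsIntegralElem z)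
    (G : Matrix (Fin dx) (Fin dx) (RatFunc K))
    (hG : ∀ j, (KaehlerDifferential.D K L) (b j) =
      ∑ i, (algebraMap (RatFunc K) L (G i j) * b i) •
        (KaehlerDifferential.D K L) (algebraMap (RatFunc K) L RatFunc.X)) :
    ∀ i j, ∃ g h : Polynomial K, h ≠ 0 ∧
      G i j = algebraMap (Polynomial K) (RatFunc K) g /
        algebraMap (Polynomial K) (RatFunc K) h ∧
      g.degree < h.degree := by
  intro i j
  have hX : (RatFunc.X : RatFunc K) ≠ 0 := RatFunc.X_ne_zero
  have hfin : FiniteDimensional (RatFunc K) L :=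
    Module.finite_def.2 (hb_span ▸ Submodule.fg_span (Set.finite_range b))
  let φ : Polynomial K →+* RatFunc K := (Polynomial.aeval ((RatFunc.X : RatFunc K)⁻¹) :
              Polynomial K →ₐ[K] RatFunc K).toRingHom
  have hφ : ∀ N r, r.natDegree ≤ N → φ r * RatFunc.X ^ N =
      algebraMap (Polynomial K) (RatFunc K) (reflect N r) := fun N r hr => refl_aux N r hr
  have hinj : Function.Injective φ := by
    rw [injective_iff_map_eq_zero]
    intro r hr
    have := hφ r.natDegree r le_rfl
    rw [hr, zero_mul] at this
    simpa using this.symm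
  have hsurj : ∀ z : RatFunc K, ∃ p q : Polynomial K, q ≠ 0 ∧ z * φ q = φ p := by
    intro z
    set N := max z.num.natDegree z.denom.natDegree with hN
    have key : ∀ r : Polynomial K, r.natDegree ≤ N → φ (reflect N r) * RatFunc.X ^ N =
        algebraMap (Polynomial K) (RatFunc K) r := by
      intro r hr
      rw [hφ N _ (natDegree_reflect_le.trans (by simp [hr])), reflect_reflect]
    refine ⟨reflect N z.num, reflect N z.denom, by simpa using z.denom_ne_zero, ?_⟩
    have hXN : (RatFunc.X : RatFunc K) ^ N ≠ 0 := pow_ne_zero _ hX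
    apply mul_right_cancel₀ hXN
    rw [mul_assoc, key _ (le_max_left _ _), key _ (le_max_right _ _)]
    have h0 : algebraMap (Polynomial K) (RatFunc K) z.denom ≠ 0 := by
      simpa using z.denom_ne_zero
    rw [← eq_div_iff h0, RatFunc.num_div_denom]
  obtain ⟨p, q, hq, h⟩ := main3 φ hinj hsurj
    (fun a => by
      rw [IsScalarTower.algebraMap_apply K (RatFunc K) L]
      congr 1
      exact (aeval_C _ a).symm)
    dx b hb_li hb_int RatFunc.X (by simp [φ]) G hG i j
  exact deg_aux (G i j) p q hq h
end

section
/- Let b⁰_0,…,b⁰_{d_x−1} be an integral basis over K[x], let G⁰ ∈ M_{d_x}(K(x)) be defined by d b⁰_j = Σ_{i=0}^{d_x−1} G⁰_{i+1,j+1} b⁰_i dx, and let x₀ be any element of an algebraic closure K̄ of K. Then the residue matrix G^{x₀}_{−1} = ((x−x₀)·G⁰)|_{x=x₀} ∈ M_{d_x}(K̄) is well defined (each entry of (x−x₀)·G⁰ is regular at x₀), and every eigenvalue of G^{x₀}_{−1}, i.e. every root in K̄ of its characteristic polynomial, is a rational number contained in the interval [0,1). -/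
open Polynomial

open scoped KaehlerDifferential TensorProduct in
theorem exists_kaehler_functional {K L : Type*} [Field K] [CharZero K] [Field L]
    [Algebra (RatFunc K) L] [Algebra K L] [IsScalarTower K (RatFunc K) L]
    [Algebra K[X] L] [IsScalarTower K[X] (RatFunc K) L] [IsScalarTower K K[X] L]
    [Algebra.IsSeparable (RatFunc K) L] :
    ∃ f : Ω[L⁄K] →ₗ[L] L, f (KaehlerDifferential.D K L (algebraMap K[X] L X)) = 1 := by
  have h1 : Algebra.FormallyEtale K[X] (RatFunc K) :=
    Algebra.FormallyEtale.of_isLocalization (nonZeroDivisors K[X])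
  have h2 : Algebra.FormallyEtale (RatFunc K) L := Algebra.FormallyEtale.of_isSeparable _ _
  have h3 : Algebra.FormallyEtale K[X] L := Algebra.FormallyEtale.comp K[X] (RatFunc K) L
  let g : Ω[K[X]⁄K] →ₗ[K[X]] K[X] := (Polynomial.derivative' (R := K)).liftKaehlerDifferential
  refine ⟨(TensorProduct.AlgebraTensorModule.rid K[X] L L).toLinearMap ∘ₗ
    (g.baseChange L) ∘ₗ
    (KaehlerDifferential.tensorKaehlerEquivOfFormallyEtale K K[X] L).symm.toLinearMap, ?_⟩
  simp only [LinearMap.comp_apply, LinearEquiv.coe_coe]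
  rw [KaehlerDifferential.tensorKaehlerEquivOfFormallyEtale_symm_D_algebraMap]
  simp [g]

theorem exists_sep_poly {K B : Type*} [Field K] [CharZero K] [CommRing B]
    [Algebra K B] [Algebra K[X] B] [IsScalarTower K K[X] B] [Algebra.IsIntegral K[X] B]
    (P : Ideal B) [P.IsPrime] (p : K[X]) (hp : p ≠ 0) (hpP : algebraMap K[X] B p ∈ P) (b : B) :
    ∃ f : K[X], aeval b f ∈ P ∧ aeval b (derivative f) ∉ P := by
  let I : Ideal K[X] := Ideal.span {p}
  let q : K[X] →+* B ⧸ P := (Ideal.Quotient.mk P).comp (algebraMap K[X] B)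
  let g : K[X] ⧸ I →+* B ⧸ P := Ideal.Quotient.lift I q (by
    intro a ha
    obtain ⟨c, rfl⟩ := Ideal.mem_span_singleton.1 ha
    simp only [q, RingHom.comp_apply, map_mul]
    rw [Ideal.Quotient.eq_zero_iff_mem.2 hpP, zero_mul])
  have hq : q.IsIntegral := by
    apply RingHom.IsIntegral.trans
    · exact algebraMap_isIntegral_iff.2 inferInstance
    · exact RingHom.isIntegral_of_surjective _ Ideal.Quotient.mk_surjective
  have hg : g.IsIntegral := by
    refine RingHom.IsIntegral.tower_top (Ideal.Quotient.mk I) g ?_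
    exact hq
  have hf : (algebraMap K (K[X] ⧸ I)).IsIntegral := by
    have : Module.Finite K (AdjoinRoot p) := by
      exact (AdjoinRoot.powerBasis hp).finite
    have h : Algebra.IsIntegral K (AdjoinRoot p) := inferInstance
    exact algebraMap_isIntegral_iff.2 h
  have hK : (algebraMap K (B ⧸ P)).IsIntegral := by
    have h1 := RingHom.IsIntegral.trans _ _ hf hg
    have h2 : algebraMap K (B ⧸ P) = g.comp (algebraMap K (K[X] ⧸ I)) := by
      refine RingHom.ext fun a => ?_
      change Ideal.Quotient.mk P (algebraMap K B a) =
        Ideal.Quotient.mk P (algebraMap K[X] B (algebraMap K K[X] a))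
      rw [← IsScalarTower.algebraMap_apply K K[X] B]
    rw [h2]
    exact h1
  have hb : IsIntegral K (Ideal.Quotient.mk P b) := hK _
  have key : ∀ f : K[X], aeval (Ideal.Quotient.mk P b) f = Ideal.Quotient.mk P (aeval b f) := by
    intro f
    have := Polynomial.aeval_algHom_apply (Ideal.Quotient.mkₐ K P) b f
    simpa using this
  refine ⟨minpoly K (Ideal.Quotient.mk P b), ?_, ?_⟩
  · rw [← Ideal.Quotient.eq_zero_iff_mem, ← key, minpoly.aeval]
  · rw [← Ideal.Quotient.eq_zero_iff_mem, ← key]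
    exact (minpoly.irreducible hb).separable.aeval_derivative_ne_zero (minpoly.aeval _ _)

open WithZero in
theorem le_exp_of_lt_exp_add_one {x : ℤᵐ⁰} {n : ℤ} (h : x < exp (n + 1)) : x ≤ exp n := by
  by_cases hx : x = 0
  · simp [hx]
  · rw [← exp_log hx, exp_lt_exp] at h
    rw [← exp_log hx, exp_le_exp]
    omega

open IsDedekindDomain WithZero in
theorem val_core {K L B : Type*} [Field K] [CharZero K] [CommRing B] [IsDedekindDomain B]
    [Field L] [Algebra B L] [IsFractionRing B L] [Algebra K L] 
    [Algebra K B] [IsScalarTower K B L] (w : HeightOneSpectrum B)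
    (θ : Derivation K L L) (p c : L) (hp0 : p ≠ 0) (hp1 : w.valuation L p < 1)
    (hc : w.valuation L c ≤ 1) (hθ : θ p = c * p)
    (hsep : ∀ b : B, ∃ f : K[X], aeval b f ∈ w.asIdeal ∧ aeval b (derivative f) ∉ w.asIdeal)
    (n₀ : ℕ) (hbd : ∀ b : B, w.valuation L (θ (algebraMap B L b)) ≤ exp (n₀ : ℤ)) :
    ∃ e : ℕ, 0 < e ∧ w.valuation L p = exp (-(e : ℤ)) ∧
      (∀ z : L, w.valuation L (θ z) ≤ w.valuation L z) ∧
      ∀ (z : L) (k : ℤ), w.valuation L z = exp (-k) →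
        w.valuation L (θ z - ((k : K) / (e : K)) • (c * z)) < w.valuation L z := by
  set v := w.valuation L with hv
  have hvK1 : ∀ a : K, v (algebraMap K L a) ≤ 1 := by
    intro a
    rw [IsScalarTower.algebraMap_apply K B L]
    exact w.valuation_le_one _
  have hvK : ∀ a : K, a ≠ 0 → v (algebraMap K L a) = 1 := by
    intro a ha
    apply le_antisymm (hvK1 a)
    have h1 := hvK1 a⁻¹
    rw [map_inv₀, map_inv₀] at h1
    exact (inv_le_one₀ (zero_lt_iff.2 (by simpa using ha))).1 h1
  have hfrac : ∀ u : L, v u = 1 → ∃ b s : B, v (algebraMap B L b) = 1 ∧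
      v (algebraMap B L s) = 1 ∧ u * algebraMap B L s = algebraMap B L b := by
    intro u hu
    obtain ⟨b, s, h⟩ := w.exists_primeCompl_mul_eq_of_integer u hu.le
    have hs : v (algebraMap B L s) = 1 := w.valuation_eq_one_iff_notMem.2 s.2
    refine ⟨b, s, ?_, hs, h⟩
    rw [← h, map_mul, hu, hs, one_mul]
  have hU : ∀ γ : ℤᵐ⁰, (∀ b : B, v (algebraMap B L b) = 1 → v (θ (algebraMap B L b)) ≤ γ) → 
      ∀ u : L, v u = 1 → v (θ u) ≤ γ := by
    intro γ hγ u hu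
    obtain ⟨b, s, hb, hs, h⟩ := hfrac u hu
    have h1 := congrArg θ h
    rw [Derivation.leibniz] at h1
    have h2 : θ u * algebraMap B L s = θ (algebraMap B L b) - u * θ (algebraMap B L s) := by
      rw [← h1]; simp only [smul_eq_mul]; ring
    have h3 : v (θ u) = v (θ u * algebraMap B L s) := by rw [map_mul, hs, mul_one]
    rw [h3, h2]
    refine (v.map_sub _ _).trans (max_le (hγ b hb) ?_)
    rw [map_mul, hu, one_mul]
    exact hγ s hs
  obtain ⟨e, he⟩ : ∃ e : ℤ, v p = exp (-e) := by
    refine ⟨- log (v p), ?_⟩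
    rw [neg_neg, exp_log]
    simpa using hp0
  have he0 : 0 < e := by
    rw [he, ← exp_zero, exp_lt_exp] at hp1
    omega
  lift e to ℕ using he0.le
  have he0' : 0 < e := by exact_mod_cast he0
  have heL : v (e : L) = 1 := by
    have := hvK e (by exact_mod_cast he0'.ne')
    simpa using this
  have hkL : ∀ k : ℤ, v (k : L) ≤ 1 := by
    intro k
    have := hvK1 k
    simpa using this
  have hE : ∀ (z : L) (k : ℤ), v z = exp (-k) → ∃ u : L, v u = 1 ∧
      v (e * θ z - k * c * z) = v (θ u) * v z := by
    intro z k hz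
    have hz0 : z ≠ 0 := by
      rintro rfl
      rw [map_zero] at hz
      exact exp_ne_zero hz.symm
    have hpk : p ^ k ≠ 0 := zpow_ne_zero _ hp0
    have hvpk : v (p ^ k) = v z ^ e := by
      rw [map_zpow₀, he, hz, ← exp_zsmul, ← exp_nsmul]
      congr 1
      simp [mul_comm]
    refine ⟨z ^ e / p ^ k, ?_, ?_⟩
    · rw [map_div₀, hvpk, map_pow, div_self]
      exact pow_ne_zero _ (by simpa using hz0)
    · have h1 : θ (z ^ e / p ^ k) * p ^ k * z = (e * θ z - k * c * z) * z ^ e := by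
        have h2 : θ (z ^ e) = θ ((z ^ e / p ^ k) * p ^ k) := by
          rw [div_mul_cancel₀ _ hpk]
        rw [Derivation.leibniz, Derivation.leibniz_pow, Derivation.leibniz_zpow, hθ] at h2
        simp only [smul_eq_mul, nsmul_eq_mul, zsmul_eq_mul] at h2
        obtain ⟨m, rfl⟩ : ∃ m, e = m + 1 := ⟨e - 1, by omega⟩
        rw [zpow_sub_one₀ hp0] at h2
        simp only [Nat.add_sub_cancel] at h2
        set t := θ (z ^ (m + 1) / p ^ k) with ht
        have h5 : z ^ (m + 1) / p ^ k * (k * (p ^ k * p⁻¹ * (c * p))) = z ^ (m + 1) * k * c := by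
          field_simp
        rw [h5] at h2
        rw [pow_succ] at h2 ⊢
        linear_combination (-z) * h2
      have h3 := congrArg v h1
      rw [map_mul, map_mul, map_mul, hvpk, map_pow] at h3
      have h4 : v z ^ e ≠ 0 := pow_ne_zero _ (by simpa using hz0)
      apply mul_right_cancel₀ h4
      rw [← h3]; exact mul_right_comm _ _ _
  have hexz : ∀ z : L, z ≠ 0 → ∃ k : ℤ, v z = exp (-k) := by
    intro z hz
    refine ⟨- log (v z), ?_⟩
    rw [neg_neg, exp_log]
    simpa using hz
  -- passing from units to everything
  have hstep : ∀ γ : ℤᵐ⁰, 1 ≤ γ → (∀ u : L, v u = 1 → v (θ u) ≤ γ) →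
      ∀ z : L, v (θ z) ≤ γ * v z := by
    intro γ hγ h z
    by_cases hz : z = 0
    · simp [hz]
    obtain ⟨k, hk⟩ := hexz z hz
    obtain ⟨u, hu, h1⟩ := hE z k hk
    have h2 : v (θ z) = v ((e * θ z - k * c * z) + k * c * z) := by
      rw [sub_add_cancel, map_mul, heL, one_mul]
    rw [h2]
    refine (v.map_add _ _).trans (max_le ?_ ?_)
    · rw [h1]
      gcongr
      exact h u hu
    · rw [map_mul, map_mul]
      gcongr
      exact (mul_le_one' (hkL k) hc).trans hγ
  -- units improve
  have himp : ∀ n : ℕ, (∀ z : L, v (θ z) ≤ exp (n : ℤ) * v z) →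
      ∀ b : B, v (algebraMap B L b) = 1 → v (θ (algebraMap B L b)) < exp (n : ℤ) := by
    intro n hn b hb
    obtain ⟨f, hf1, hf2⟩ := hsep b
    have h1 : θ (aeval (algebraMap B L b) f) =
        aeval (algebraMap B L b) (derivative f) * θ (algebraMap B L b) := by
      rw [Derivation.map_aeval]; rfl
    rw [Polynomial.aeval_algebraMap_apply, Polynomial.aeval_algebraMap_apply] at h1
    have h2 : v (algebraMap B L (aeval b f)) < 1 := (w.valuation_lt_one_iff_mem _).2 hf1
    have h3 : v (algebraMap B L (aeval b (derivative f))) = 1 :=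
      (w.valuation_eq_one_iff_notMem).2 hf2
    have h4 := congrArg v h1
    rw [map_mul, h3, one_mul] at h4
    rw [← h4]
    refine (hn _).trans_lt ?_
    calc exp (n : ℤ) * _ < exp (n : ℤ) * 1 := by
          exact mul_lt_mul_of_pos_left h2 (by simp)
      _ = _ := mul_one _
  have hdesc : ∀ n : ℕ, (∀ z : L, v (θ z) ≤ exp (n : ℤ) * v z) → ∀ z : L, v (θ z) ≤ v z := by
    intro n
    induction n with
    | zero => intro h; simpa using h
    | succ n ih =>
      intro h
      apply ih
      apply hstep
      · rw [← exp_zero, exp_le_exp]; positivity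
      · apply hU
        intro b hb
        have := himp _ h b hb
        push_cast at this
        exact le_exp_of_lt_exp_add_one this
  have hmain : ∀ z : L, v (θ z) ≤ v z := by
    apply hdesc n₀
    apply hstep
    · rw [← exp_zero, exp_le_exp]; positivity
    · apply hU
      intro b hb
      exact hbd b
  refine ⟨e, he0', he, hmain, ?_⟩
  intro z k hk
  obtain ⟨u, hu, h1⟩ := hE z k hk
  have h2 : v (θ u) < 1 := by
    have h3 : v (θ u) ≤ exp (-1 : ℤ) := by
      apply hU _ _ u hu
      intro b hb
      have := himp 0 (by simpa using hmain) b hb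
      exact le_exp_of_lt_exp_add_one (by simpa using this)
    exact h3.trans_lt (by rw [← exp_zero, exp_lt_exp]; norm_num)
  have hvz : 0 < v z := by rw [hk]; simp
  have h4 : v (θ z - ((k : K) / (e : K)) • (c * z)) = v (e * θ z - k * c * z) := by
    have heL0 : (e : L) ≠ 0 := by rintro h; rw [h] at heL; simp at heL
    have h5 : (e * θ z - k * c * z) = e * (θ z - ((k : K) / (e : K)) • (c * z)) := by
      rw [Algebra.smul_def, map_div₀]
      simp only [map_intCast, map_natCast]
      field_simp
    rw [h5, map_mul, heL, one_mul]
  rw [h4, h1]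
  calc v (θ u) * v z < 1 * v z := mul_lt_mul_of_pos_right h2 hvz
    _ = _ := one_mul _

theorem exists_ker_of_eigen {k E : Type*} [Field k] [Field E] [Algebra k E] {n : ℕ}
    (N : Matrix (Fin n) (Fin n) k) (ν : E) (u : Fin n → E) (hu : u ≠ 0)
    (h : (N.map (algebraMap k E)).mulVec u = ν • u) :
    ∃ p : Fin n → k, p ≠ 0 ∧ (aeval N (minpoly k ν)).mulVec p = 0 := by
  rw [Matrix.exists_mulVec_eq_zero_iff]
  apply (algebraMap k E).injective
  rw [map_zero, RingHom.map_det]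
  apply Matrix.exists_mulVec_eq_zero_iff.1
  refine ⟨u, hu, ?_⟩
  have key : ∀ f : k[X], ((algebraMap k E).mapMatrix (aeval N f)).mulVec u = aeval ν f • u := by
    intro f
    induction f using Polynomial.induction_on' with
    | add f g hf hg => 
      rw [map_add, map_add, Matrix.add_mulVec, hf, hg, map_add, add_smul]
    | monomial i a =>
      have hp : ∀ i : ℕ, ((N.map (algebraMap k E)) ^ i).mulVec u = ν ^ i • u := by
        intro i
        induction i with
        | zero => simp
        | succ i ih => 
          rw [pow_succ, ← Matrix.mulVec_mulVec, h, Matrix.mulVec_smul, ih, smul_smul, pow_succ']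
      rw [aeval_monomial, aeval_monomial, map_mul, map_pow]
      have h1 : (algebraMap k E).mapMatrix (algebraMap k (Matrix (Fin n) (Fin n) k) a) =
          algebraMap E (Matrix (Fin n) (Fin n) E) (algebraMap k E a) := by
        ext i j
        simp [Matrix.algebraMap_matrix_apply]
        split_ifs <;> simp
      rw [h1, ← Matrix.mulVec_mulVec]
      have h2 := hp i
      rw [RingHom.mapMatrix_apply, h2, Matrix.mulVec_smul, Algebra.algebraMap_eq_smul_one,
        Matrix.smul_mulVec, Matrix.one_mulVec, smul_smul, mul_comm]
  rw [key, minpoly.aeval, zero_smul]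

section core

set_option linter.unusedSectionVars false

variable {K L : Type*} [Field K] [CharZero K] [Field L]
    [Algebra (RatFunc K) L] [Algebra K L] [IsScalarTower K (RatFunc K) L]
    [Algebra K[X] L] [IsScalarTower K[X] (RatFunc K) L] [IsScalarTower K K[X] L]
    [FiniteDimensional (RatFunc K) L]

open IsDedekindDomain WithZero

theorem deriv_algebraMap (D : Derivation K L L) (hD : D (algebraMap K[X] L X) = 1) (f : K[X]) :
    D (algebraMap K[X] L f) = algebraMap K[X] L (derivative f) := by
  have h : ∀ f : K[X], algebraMap K[X] L f = aeval (algebraMap K[X] L X) f := by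
    intro f
    rw [aeval_algebraMap_apply, aeval_X_left_apply]
  rw [h f, Derivation.map_aeval, hD, h (derivative f)]
  simp

theorem isDed : IsDedekindDomain (integralClosure K[X] L) :=
  integralClosure.isDedekindDomain K[X] (RatFunc K) L

theorem isFrac : IsFractionRing (integralClosure K[X] L) L :=
  integralClosure.isFractionRing_of_finite_extension (RatFunc K) L

/-- Valuation data at the places above the irreducible polynomial `q`. -/
theorem place_data [IsDedekindDomain (integralClosure K[X] L)]
    [IsFractionRing (integralClosure K[X] L) L]
    (D : Derivation K L L) (hD : D (algebraMap K[X] L X) = 1)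
    (q h₀ : K[X]) (hq : Irreducible q) (m : ℕ)
    (hbd : ∀ z : L, IsIntegral K[X] z →
      IsIntegral K[X] (algebraMap K[X] L (q ^ m) * (algebraMap K[X] L (q * h₀) * D z)))
    (w : HeightOneSpectrum (integralClosure K[X] L))
    (hw : w.valuation L (algebraMap K[X] L q) < 1) :
    ∃ e : ℕ, 0 < e ∧ w.valuation L (algebraMap K[X] L q) = exp (-(e : ℤ)) ∧
      (∀ z : L, w.valuation L (algebraMap K[X] L (q * h₀) * D z) ≤ w.valuation L z) ∧
      ∀ (z : L) (k : ℤ), w.valuation L z = exp (-k) →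
        w.valuation L (algebraMap K[X] L (q * h₀) * D z -
          algebraMap K[X] L (C ((k : K) / (e : K)) * (h₀ * derivative q)) * z) <
          w.valuation L z := by
  have hinj : Function.Injective (algebraMap K[X] L) := by
    rw [IsScalarTower.algebraMap_eq K[X] (RatFunc K) L]
    exact (algebraMap (RatFunc K) L).injective.comp (IsFractionRing.injective K[X] (RatFunc K))
  have hq0 : algebraMap K[X] L q ≠ 0 := by
    rw [Ne, map_eq_zero_iff _ hinj]; exact hq.ne_zero
  have hval : ∀ z : L, IsIntegral K[X] z → w.valuation L z ≤ 1 := fun z hz =>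
    w.valuation_le_one (⟨z, hz⟩ : integralClosure K[X] L)
  have hvalA : ∀ f : K[X], w.valuation L (algebraMap K[X] L f) ≤ 1 := fun f =>
    hval _ isIntegral_algebraMap
  have hvq : w.valuation L (algebraMap K[X] L q) ≠ 0 := by simpa using hq0
  obtain ⟨e, he, he1, he2, he3⟩ := val_core (K := K) w (algebraMap K[X] L (q * h₀) • D)
    (algebraMap K[X] L q) (algebraMap K[X] L (h₀ * derivative q)) hq0 hw (hvalA _)
    (by
      rw [Derivation.smul_apply, deriv_algebraMap D hD, smul_eq_mul, ← map_mul, ← map_mul]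
      congr 1; ring)
    (fun b => by
      refine exists_sep_poly w.asIdeal q hq.ne_zero ?_ b
      rw [← w.valuation_lt_one_iff_mem (K := L)]
      exact hw)
    (log ((w.valuation L (algebraMap K[X] L q))⁻¹ ^ m)).toNat
    (fun b => by
      have h1 := hval _ (hbd (algebraMap _ L b) b.2)
      rw [map_mul, map_pow, map_pow, mul_comm, ← le_mul_inv_iff₀ (zero_lt_iff.2 (pow_ne_zero _ hvq)), one_mul] at h1
      rw [Derivation.smul_apply, smul_eq_mul]
      refine h1.trans ?_
      rw [← inv_pow]
      refine (exp_log (pow_ne_zero _ (inv_ne_zero hvq))).ge.trans ?_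
      rw [exp_le_exp]
      exact Int.self_le_toNat _)
  refine ⟨e, he, he1, ?_, ?_⟩
  · intro z; exact he2 z
  · intro z k hz
    have := he3 z k hz
    convert this using 2
    rw [Derivation.smul_apply, smul_eq_mul, map_mul _ (C _), Algebra.smul_def, ← mul_assoc]
    congr 3
    rw [IsScalarTower.algebraMap_apply K K[X] L]
    rfl

theorem exists_residue [IsDedekindDomain (integralClosure K[X] L)]
    [IsFractionRing (integralClosure K[X] L) L]
    (D : Derivation K L L) (hD : D (algebraMap K[X] L X) = 1)
    (n : ℕ) (b : Fin n → L) (hli : LinearIndependent (RatFunc K) b)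
    (hb : ∀ z : L, (∃ c : Fin n → K[X], z = ∑ i, algebraMap K[X] L (c i) * b i) ↔
      IsIntegral K[X] z)
    (G : Matrix (Fin n) (Fin n) (RatFunc K))
    (hG : ∀ j, D (b j) = ∑ i, algebraMap (RatFunc K) L (G i j) * b i)
    (q : K[X]) (hq : Irreducible q) :
    ∃ (m : ℕ) (h₀ : K[X]) (N : Matrix (Fin n) (Fin n) K[X]), ¬ q ∣ h₀ ∧
      (∀ i j, G i j = algebraMap K[X] (RatFunc K) (N i j) / 
        algebraMap K[X] (RatFunc K) (q * h₀)) ∧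
      (∀ z : L, IsIntegral K[X] z →
        IsIntegral K[X] (algebraMap K[X] L (q ^ m) * (algebraMap K[X] L (q * h₀) * D z))) := by
  have hinj : Function.Injective (algebraMap K[X] L) := by
    rw [IsScalarTower.algebraMap_eq K[X] (RatFunc K) L]
    exact (algebraMap (RatFunc K) L).injective.comp (IsFractionRing.injective K[X] (RatFunc K))
  obtain ⟨⟨h, hh⟩, hN'⟩ := IsLocalization.exist_integer_multiples_of_finite
    (nonZeroDivisors K[X]) (fun ij : Fin n × Fin n => G ij.1 ij.2)
  have hh0 : h ≠ 0 := nonZeroDivisors.ne_zero hh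
  obtain ⟨m, h₀, hqh, rfl⟩ : ∃ (m : ℕ) (h₀ : K[X]), ¬ q ∣ h₀ ∧ h = q ^ m * h₀ := by
    obtain ⟨c, hc1, hc2⟩ := (FiniteMultiplicity.of_not_isUnit hq.not_isUnit 
      hh0).exists_eq_pow_mul_and_not_dvd
    exact ⟨_, c, hc2, hc1⟩
  have hbint : ∀ i, IsIntegral K[X] (b i) := fun i => (hb _).1 ⟨Pi.single i 1, by
    simp [Pi.single_apply, ite_mul]⟩
  have hbd0 : ∀ j, IsIntegral K[X] (algebraMap K[X] L (q ^ m * h₀) * D (b j)) := by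
    intro j
    choose N' hN' using fun ij => hN' ij
    refine (hb _).1 ⟨fun i => N' (i, j), ?_⟩
    rw [hG, Finset.mul_sum]
    refine Finset.sum_congr rfl fun i _ => ?_
    rw [← mul_assoc]
    congr 1
    have := hN' (i, j)
    rw [IsScalarTower.algebraMap_apply K[X] (RatFunc K) L, 
      IsScalarTower.algebraMap_apply K[X] (RatFunc K) L (N' _), this, ← map_mul, Algebra.smul_def]
  have hbd : ∀ z : L, IsIntegral K[X] z →
        IsIntegral K[X] (algebraMap K[X] L (q ^ m) * (algebraMap K[X] L (q * h₀) * D z)) := by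
    intro z hz
    obtain ⟨c, rfl⟩ := (hb z).2 hz
    have h1 : algebraMap K[X] L (q ^ m) * (algebraMap K[X] L (q * h₀) *
        D (∑ i, algebraMap K[X] L (c i) * b i)) = ∑ i, (algebraMap K[X] L (q * c i) *
        (algebraMap K[X] L (q ^ m * h₀) * D (b i)) +
        algebraMap K[X] L (q ^ m * (q * h₀) * derivative (c i)) * b i) := by
      rw [map_sum, Finset.mul_sum, Finset.mul_sum]
      refine Finset.sum_congr rfl fun i _ => ?_
      rw [Derivation.leibniz, deriv_algebraMap D hD]
      simp only [smul_eq_mul, map_mul]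
      ring
    rw [h1]
    refine IsIntegral.sum _ fun i _ => ?_
    exact (isIntegral_algebraMap.mul (hbd0 i)).add (isIntegral_algebraMap.mul (hbint i))
  have hpres : ∀ z : L, IsIntegral K[X] z → IsIntegral K[X] (algebraMap K[X] L (q * h₀) * D z) := by
    intro z hz
    have h1 : algebraMap K[X] L (q * h₀) * D z ∈ 
        (algebraMap (integralClosure K[X] L) L).range := by
      apply HeightOneSpectrum.mem_integers_of_valuation_le_one
      intro w
      have hval : ∀ z : L, IsIntegral K[X] z → w.valuation L z ≤ 1 := fun z hz =>
        w.valuation_le_one (⟨z, hz⟩ : integralClosure K[X] L)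
      rcases (hval (algebraMap K[X] L q) isIntegral_algebraMap).lt_or_eq with hw | hw
      · obtain ⟨e, -, -, he, -⟩ := place_data D hD q h₀ hq m hbd w hw
        exact (he z).trans (hval z hz)
      · have := hval _ (hbd z hz)
        rwa [map_mul, map_pow, map_pow, hw, one_pow, one_mul] at this
    obtain ⟨y, hy⟩ := h1
    rw [← hy]
    exact y.2
  choose N hN using fun j => (hb _).2 (hpres (b j) (hbint j))
  refine ⟨m, h₀, fun i j => N j i, hqh, ?_, hbd⟩
  intro i j
  have h0 : algebraMap K[X] (RatFunc K) (q * h₀) ≠ 0 := by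
    rw [Ne, map_eq_zero_iff _ (IsFractionRing.injective K[X] (RatFunc K))]
    refine mul_ne_zero hq.ne_zero ?_
    rintro rfl
    exact hqh (dvd_zero _)
  rw [eq_div_iff h0]
  have h1 := hN j
  rw [hG, Finset.mul_sum] at h1
  have h2 : ∑ i, (G i j * algebraMap K[X] (RatFunc K) (q * h₀)) • b i =
      ∑ i, (algebraMap K[X] (RatFunc K) (N j i)) • b i := by
    simp only [Algebra.smul_def, map_mul]
    simp only [← IsScalarTower.algebraMap_apply K[X] (RatFunc K) L]
    rw [← h1]
    refine Finset.sum_congr rfl fun i _ => ?_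
    rw [map_mul]
    ring
  exact Fintype.linearIndependent_iffₛ.1 hli _ _ h2 i

theorem eigen_rational [IsDedekindDomain (integralClosure K[X] L)]
    [IsFractionRing (integralClosure K[X] L) L]
    (D : Derivation K L L) (hD : D (algebraMap K[X] L X) = 1)
    (n : ℕ) (b : Fin n → L) (hli : LinearIndependent (RatFunc K) b)
    (hb : ∀ z : L, (∃ c : Fin n → K[X], z = ∑ i, algebraMap K[X] L (c i) * b i) ↔
      IsIntegral K[X] z)
    (q h₀ : K[X]) (hq : Irreducible q) (m : ℕ)
    (hbd : ∀ z : L, IsIntegral K[X] z →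
      IsIntegral K[X] (algebraMap K[X] L (q ^ m) * (algebraMap K[X] L (q * h₀) * D z)))
    (N : Matrix (Fin n) (Fin n) K[X])
    (hN : ∀ j, algebraMap K[X] L (q * h₀) * D (b j) = ∑ i, algebraMap K[X] L (N i j) * b i)
    {k E : Type*} [Field k] [Field E] [Algebra k E] (φ : K[X] →+* k)
    (hφs : Function.Surjective φ) (hφ : ∀ f, φ f = 0 ↔ q ∣ f)
    (ν : E) (hνi : IsIntegral k ν) (u : Fin n → E) (hu : u ≠ 0)
    (hν : ((N.map φ).map (algebraMap k E)).mulVec u = ν • u) :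
    ∃ (κ e : ℕ), κ < e ∧ ν = algebraMap k E (φ (C ((κ : K) / (e : K)) * (h₀ * derivative q))) := by
  have hinj : Function.Injective (algebraMap K[X] L) := by
    rw [IsScalarTower.algebraMap_eq K[X] (RatFunc K) L]
    exact (algebraMap (RatFunc K) L).injective.comp (IsFractionRing.injective K[X] (RatFunc K))
  have hq0 : algebraMap K[X] L q ≠ 0 := by
    rw [Ne, map_eq_zero_iff _ hinj]; exact hq.ne_zero
  obtain ⟨p, hp0, hp⟩ := exists_ker_of_eigen (N.map φ) ν u hu hν
  obtain ⟨g, hg⟩ := Polynomial.map_surjective φ hφs (minpoly k ν)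
  choose c hc using fun i => hφs (p i)
  let β : (Fin n → K[X]) → L := fun c => ∑ i, algebraMap K[X] L (c i) * b i
  have hβ : ∀ c, β c = ∑ i, algebraMap K[X] L (c i) * b i := fun c => rfl
  have hβinj : Function.Injective β := by
    intro c d hcd
    have h1 : ∑ i, (algebraMap K[X] (RatFunc K) (c i)) • b i =
        ∑ i, (algebraMap K[X] (RatFunc K) (d i)) • b i := by
      simp only [Algebra.smul_def, ← IsScalarTower.algebraMap_apply K[X] (RatFunc K) L]
      exact hcd
    have h2 := Fintype.linearIndependent_iffₛ.1 hli _ _ h1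
    ext1 i
    exact IsFractionRing.injective K[X] (RatFunc K) (h2 i)
  have hβq : ∀ c, algebraMap K[X] L q * β c = β (fun i => q * c i) := by
    intro c
    simp only [hβ, Finset.mul_sum, map_mul, mul_assoc]
  set z := β c with hz
  have hzint : IsIntegral K[X] z := (hb _).1 ⟨c, rfl⟩
  have hznot : ¬ IsIntegral K[X] (z / algebraMap K[X] L q) := by
    intro h
    obtain ⟨d, hd⟩ := (hb _).2 h
    rw [div_eq_iff hq0, mul_comm] at hd
    have h1 := hβinj (hd.trans (hβq d))
    apply hp0
    ext1 i
    rw [← hc, h1]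
    exact (hφ _).2 (dvd_mul_right _ _)
  obtain ⟨w, hw⟩ : ∃ w : HeightOneSpectrum (integralClosure K[X] L),
      ¬ w.valuation L (z / algebraMap K[X] L q) ≤ 1 := by
    by_contra! hcon
    obtain ⟨y, hy⟩ := HeightOneSpectrum.mem_integers_of_valuation_le_one _ _ hcon
    apply hznot
    rw [← hy]
    exact y.2
  set v := w.valuation L with hv
  have hval : ∀ z : L, IsIntegral K[X] z → v z ≤ 1 := fun z hz =>
    w.valuation_le_one (⟨z, hz⟩ : integralClosure K[X] L)
  have hvalA : ∀ f : K[X], v (algebraMap K[X] L f) ≤ 1 := fun f =>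
    hval _ isIntegral_algebraMap
  have hvq : 0 < v (algebraMap K[X] L q) := zero_lt_iff.2 (by simpa using hq0)
  have hqz : v (algebraMap K[X] L q) < v z := by
    rw [map_div₀, div_le_one₀ hvq, not_le] at hw
    exact hw
  have hz0 : 0 < v z := hvq.trans hqz
  have hq1 : v (algebraMap K[X] L q) < 1 := hqz.trans_le (hval z hzint)
  obtain ⟨e, he, heq, hmono, hlead⟩ := place_data D hD q h₀ hq m hbd w hq1
  obtain ⟨κ, hκ⟩ : ∃ κ : ℤ, v z = exp (-κ) := ⟨-log (v z), by
    rw [neg_neg, exp_log hz0.ne']⟩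
  have hκ0 : 0 ≤ κ := by
    have := hval z hzint
    rw [hκ, ← exp_zero, exp_le_exp] at this
    omega
  have hκe : κ < e := by
    have h1 := hqz
    rw [hκ, hv, heq, exp_lt_exp] at h1
    omega
  have hl := hlead z κ hκ
  lift κ to ℕ using hκ0
  refine ⟨κ, e, by exact_mod_cast hκe, ?_⟩
  rw [Int.cast_natCast] at hl
  set ρ : K[X] := C ((κ : K) / (e : K)) * (h₀ * derivative q) with hρ
  set θ : L → L := fun z => algebraMap K[X] L (q * h₀) * D z with hθ
  have hθdef : ∀ z, θ z = algebraMap K[X] L (q * h₀) * D z := fun z => rfl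
  have hθmul : ∀ (f : K[X]) (y : L), θ (algebraMap K[X] L f * y) =
      algebraMap K[X] L q * (algebraMap K[X] L (h₀ * derivative f) * y) +
        algebraMap K[X] L f * θ y := by
    intro f y
    simp only [hθdef, Derivation.leibniz, deriv_algebraMap D hD, smul_eq_mul, map_mul]
    ring
  have hlt : ∀ (a y : L), v a ≤ 1 → v y < v z → v (a * y) < v z := by
    intro a y ha hy
    rw [map_mul]
    exact (mul_le_of_le_one_left' ha).trans_lt hy
  -- iterates of θ on z modulo higher order
  have hiter : ∀ i : ℕ, v (θ^[i] z - algebraMap K[X] L (ρ ^ i) * z) < v z := by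
    intro i
    induction i with
    | zero => simpa using hz0
    | succ i ih =>
      rw [Function.iterate_succ_apply']
      have h1 : θ (θ^[i] z) - algebraMap K[X] L (ρ ^ (i + 1)) * z =
          θ (θ^[i] z - algebraMap K[X] L (ρ ^ i) * z) +
          (algebraMap K[X] L (h₀ * derivative (ρ ^ i)) * z * algebraMap K[X] L q +
          algebraMap K[X] L (ρ ^ i) * (θ z - algebraMap K[X] L ρ * z)) := by
        have h2 : θ (θ^[i] z - algebraMap K[X] L (ρ ^ i) * z) =
            θ (θ^[i] z) - θ (algebraMap K[X] L (ρ ^ i) * z) := by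
          simp only [hθdef, map_sub, mul_sub]
        rw [h2, hθmul, pow_succ, map_mul _ (ρ ^ i) ρ]
        ring
      rw [h1]
      refine v.map_add_lt ((hmono _).trans_lt ih) (v.map_add_lt ?_ ?_)
      · exact hlt _ _ (by rw [map_mul]; exact mul_le_one' (hvalA _) (hval z hzint)) hqz
      · exact hlt _ _ (hvalA _) hl
  -- iterates of θ on z in coordinates
  have hcoord : ∀ i : ℕ, ∃ d : Fin n → K[X], θ^[i] z = β d ∧
      (fun i => φ (d i)) = ((N.map φ) ^ i).mulVec p := by
    intro i
    induction i with
    | zero => exact ⟨c, rfl, by ext1 i; simp [hc]⟩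
    | succ i ih =>
      obtain ⟨d, hd1, hd2⟩ := ih
      refine ⟨fun i => q * (h₀ * derivative (d i)) + N.mulVec d i, ?_, ?_⟩
      · rw [Function.iterate_succ_apply', hd1]
        have h1 : θ (β d) = ∑ j, θ (algebraMap K[X] L (d j) * b j) := by
          simp only [hθdef, hβ, map_sum, Finset.mul_sum]
        have h2 : ∀ j, θ (b j) = ∑ i, algebraMap K[X] L (N i j) * b i := hN
        rw [h1, hβ]
        simp only [hθmul, h2, map_add, add_mul, Finset.sum_add_distrib]
        congr 1
        · refine Finset.sum_congr rfl fun j _ => ?_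
          rw [map_mul _ q, mul_assoc]
        · simp only [Finset.mul_sum]
          rw [Finset.sum_comm]
          refine Finset.sum_congr rfl fun j _ => ?_
          simp only [Matrix.mulVec, dotProduct, map_sum, Finset.sum_mul, map_mul]
          refine Finset.sum_congr rfl fun l _ => ?_
          ring
      · rw [pow_succ', ← Matrix.mulVec_mulVec, ← hd2]
        ext1 i
        rw [map_add, (hφ _).2 (dvd_mul_right _ _), zero_add]
        simp only [Matrix.mulVec, dotProduct, map_sum, map_mul, Matrix.map_apply]
  choose d hd1 hd2 using hcoord
  -- g(θ) z
  have hgz : v (∑ i ∈ Finset.range (g.natDegree + 1), algebraMap K[X] L (g.coeff i) * θ^[i] z) <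
      v z := by
    have h1 : ∑ i ∈ Finset.range (g.natDegree + 1), algebraMap K[X] L (g.coeff i) * θ^[i] z =
        β (fun j => ∑ i ∈ Finset.range (g.natDegree + 1), g.coeff i * d i j) := by
      simp only [hd1, hβ, map_sum, Finset.mul_sum, Finset.sum_mul, map_mul]
      rw [Finset.sum_comm]
      simp only [mul_assoc]
    have h2 : ∀ j, q ∣ ∑ i ∈ Finset.range (g.natDegree + 1), g.coeff i * d i j := by
      intro j
      rw [← hφ, map_sum]
      have h3 := congrFun hp j
      rw [← hg, aeval_eq_sum_range' (n := g.natDegree + 1)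
        (Nat.lt_succ_of_le natDegree_map_le)] at h3
      rw [Matrix.sum_mulVec, Finset.sum_apply] at h3
      rw [← Pi.zero_apply (M := fun _ : Fin n => k) j, ← h3]
      refine Finset.sum_congr rfl fun i _ => ?_
      rw [map_mul, Matrix.smul_mulVec, Pi.smul_apply, ← hd2, coeff_map, smul_eq_mul]
    choose s hs using h2
    have h3 : (fun j => ∑ i ∈ Finset.range (g.natDegree + 1), g.coeff i * d i j) =
        fun j => q * s j := funext hs
    rw [h1, h3, ← hβq, mul_comm]
    exact hlt _ _ (hval _ ((hb _).1 ⟨s, rfl⟩)) hqz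
  have hgz2 : v (algebraMap K[X] L (g.eval ρ) * z) < v z := by
    have h1 : algebraMap K[X] L (g.eval ρ) * z =
        ∑ i ∈ Finset.range (g.natDegree + 1), algebraMap K[X] L (g.coeff i) * θ^[i] z -
        ∑ i ∈ Finset.range (g.natDegree + 1), algebraMap K[X] L (g.coeff i) *
          (θ^[i] z - algebraMap K[X] L (ρ ^ i) * z) := by
      rw [← Finset.sum_sub_distrib, eval_eq_sum_range, map_sum, Finset.sum_mul]
      refine Finset.sum_congr rfl fun i _ => ?_
      rw [map_mul]; ring
    rw [h1]
    refine v.map_sub_lt hgz (v.map_sum_lt hz0.ne' fun i _ => ?_)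
    exact hlt _ _ (hvalA _) (hiter i)
  have hgρ : v (algebraMap K[X] L (g.eval ρ)) < 1 := by
    rw [map_mul] at hgz2
    by_contra! hcon
    exact absurd hgz2 (not_lt.2 (le_mul_of_one_le_left' hcon))
  have hdvd : q ∣ g.eval ρ := by
    by_contra hcon
    obtain ⟨s, t, hst⟩ := (hq.coprime_iff_not_dvd).2 hcon
    have h1 := congrArg (fun f => v (algebraMap K[X] L f)) hst
    simp only [map_one, map_add, map_mul] at h1
    refine absurd h1 (ne_of_lt (v.map_add_lt ?_ ?_))
    · rw [map_mul]
      exact (mul_le_of_le_one_left' (hvalA _)).trans_lt hq1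
    · rw [map_mul]
      exact (mul_le_of_le_one_left' (hvalA _)).trans_lt hgρ
  have hroot : (minpoly k ν).IsRoot (φ ρ) := by
    rw [← hg, IsRoot, eval_map, eval₂_at_apply]
    exact (hφ _).2 hdvd
  exact (minpoly.root hνi hroot).symm

end core


/-- **The exponents of `G⁰ dx` at finite points are rational numbers in `[0,1)`**
(Proposition 2.7 of the paper, finite part).  Setup: `K` a field of characteristic zero,
`Q ∈ K[x][y]` monic in `y` of degree `d_x ≥ 1` and irreducible over `K(x)`,
`L = K(x)[y]/(Q)` (presented as a field `L` with a generating root `y` of `Q`),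
`b⁰ = (b 0, …, b (d_x - 1))` an integral basis for `L` over `K[x]`, and `G⁰ = G` the
matrix over `K(x)` with `d (b j) = ∑ i, G i j • b i • dx` in `Ω¹_{L/K}`.  Then for any
point `x₀` of an algebraic closure `K̄` of `K`, the residue matrix
`G^{x₀}_{-1} = ((x - x₀)·G)|_{x = x₀} ∈ M_{d_x}(K̄)` is well defined (each entry of
`(x - x₀)·G` is regular at `x₀`, expressed below by exhibiting, for each entry `g/h` of
`G`, polynomials `a, c` over `K̄` with `c(x₀) ≠ 0` and `a·h = (x - x₀)·g·c`, the value
being `a(x₀)/c(x₀)`), and every eigenvalue of `G^{x₀}_{-1}`, i.e. every root in `K̄` of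
its characteristic polynomial, is a rational number in `[0,1)`. -/
theorem exponents_at_finite_points_rational_in_unit_interval {K L : Type*} [Field K]
    [CharZero K]
    [Field L] [Algebra (RatFunc K) L] [Algebra K L] [IsScalarTower K (RatFunc K) L]
    (dx : ℕ) (hdx : 1 ≤ dx)
    (Q : Polynomial (Polynomial K)) (hQM : Q.Monic) (hQdeg : Q.natDegree = dx)
    (hQirr : Irreducible (Q.map (algebraMap (Polynomial K) (RatFunc K))))
    (y : L) (hy : Polynomial.aeval y (Q.map (algebraMap (Polynomial K) (RatFunc K))) = 0)
    (hgen : Algebra.adjoin (RatFunc K) {y} = ⊤)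
    (b : Fin dx → L)
    (hb_li : LinearIndependent (RatFunc K) b)
    (hb_span : Submodule.span (RatFunc K) (Set.range b) = ⊤)
    (hb_int : ∀ z : L,
      (∃ c : Fin dx → Polynomial K,
          z = ∑ i, algebraMap (RatFunc K) L (algebraMap (Polynomial K) (RatFunc K) (c i)) * b i)
        ↔ ((algebraMap (RatFunc K) L).comp
            (algebraMap (Polynomial K) (RatFunc K))).IsIntegralElem z)
    (G : Matrix (Fin dx) (Fin dx) (RatFunc K))
    (hG : ∀ j, (KaehlerDifferential.D K L) (b j) =
      ∑ i, (algebraMap (RatFunc K) L (G i j) * b i) •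
        (KaehlerDifferential.D K L) (algebraMap (RatFunc K) L RatFunc.X))
    (x₀ : AlgebraicClosure K) :
    ∃ M : Matrix (Fin dx) (Fin dx) (AlgebraicClosure K),
      (∀ i j, ∃ g h : Polynomial K, h ≠ 0 ∧
        G i j = algebraMap (Polynomial K) (RatFunc K) g /
          algebraMap (Polynomial K) (RatFunc K) h ∧
        ∃ a c : Polynomial (AlgebraicClosure K), c.eval x₀ ≠ 0 ∧
          a * h.map (algebraMap K (AlgebraicClosure K)) =
            (Polynomial.X - Polynomial.C x₀) * g.map (algebraMap K (AlgebraicClosure K)) * c ∧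
          M i j = a.eval x₀ / c.eval x₀) ∧
      (∀ μ : AlgebraicClosure K, (Matrix.charpoly M).IsRoot μ →
        ∃ a : ℚ, 0 ≤ a ∧ a < 1 ∧ μ = (a : AlgebraicClosure K)) := by
  let : Algebra K[X] L := ((algebraMap (RatFunc K) L).comp
    (algebraMap (Polynomial K) (RatFunc K))).toAlgebra
  have : IsScalarTower K[X] (RatFunc K) L := IsScalarTower.of_algebraMap_eq fun _ => rfl
  have : IsScalarTower K K[X] L := IsScalarTower.of_algebraMap_eq fun a => by
    rw [IsScalarTower.algebraMap_apply K (RatFunc K) L,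
      IsScalarTower.algebraMap_apply K K[X] (RatFunc K),
      ← IsScalarTower.algebraMap_apply K[X] (RatFunc K) L]
  have : FiniteDimensional (RatFunc K) L := by
    refine ⟨?_⟩
    rw [← hb_span]
    exact Submodule.fg_span (Set.finite_range b)
  have : IsDedekindDomain (integralClosure K[X] L) := isDed
  have : IsFractionRing (integralClosure K[X] L) L := isFrac
  have hX : algebraMap (RatFunc K) L RatFunc.X = algebraMap K[X] L X := by
    rw [IsScalarTower.algebraMap_apply K[X] (RatFunc K) L, RatFunc.algebraMap_X]
  obtain ⟨F, hF⟩ := exists_kaehler_functional (K := K) (L := L)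
  let D : Derivation K L L := F.compDer (KaehlerDifferential.D K L)
  have hD : D (algebraMap K[X] L X) = 1 := hF
  have hGD : ∀ j, D (b j) = ∑ i, algebraMap (RatFunc K) L (G i j) * b i := by
    intro j
    change F (KaehlerDifferential.D K L (b j)) = _
    rw [hG j, map_sum]
    refine Finset.sum_congr rfl fun i _ => ?_
    rw [map_smul, hX, hF, smul_eq_mul, mul_one]
  have hb : ∀ z : L, (∃ c : Fin dx → K[X], z = ∑ i, algebraMap K[X] L (c i) * b i) ↔
      IsIntegral K[X] z := hb_int
  have hx₀ : IsIntegral K x₀ := Algebra.IsIntegral.isIntegral x₀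
  have hq : Irreducible (minpoly K x₀) := minpoly.irreducible hx₀
  obtain ⟨m, h₀, N, hqh, hGN, hbd⟩ := exists_residue D hD dx b hb_li hb G hGD _ hq
  have hh0 : minpoly K x₀ * h₀ ≠ 0 := by
    refine mul_ne_zero hq.ne_zero ?_
    rintro rfl
    exact hqh (dvd_zero _)
  have hN : ∀ j, algebraMap K[X] L (minpoly K x₀ * h₀) * D (b j) =
      ∑ i, algebraMap K[X] L (N i j) * b i := by
    intro j
    rw [hGD, Finset.mul_sum]
    refine Finset.sum_congr rfl fun i _ => ?_
    rw [hGN, ← mul_assoc, IsScalarTower.algebraMap_apply K[X] (RatFunc K) L, ← map_mul,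
      IsScalarTower.algebraMap_apply K[X] (RatFunc K) L (N i j), mul_div_cancel₀]
    rw [Ne, map_eq_zero_iff _ (IsFractionRing.injective K[X] (RatFunc K))]
    exact hh0
  obtain ⟨p₁, hp₁⟩ : (X - C x₀) ∣ (minpoly K x₀).map (algebraMap K (AlgebraicClosure K)) := by
    rw [dvd_iff_isRoot, IsRoot, eval_map_algebraMap, minpoly.aeval]
  have hev : ∀ f : K[X], (f.map (algebraMap K (AlgebraicClosure K))).eval x₀ = aeval x₀ f :=
    fun f => eval_map_algebraMap _ _
  have hp₁ev : p₁.eval x₀ = aeval x₀ (derivative (minpoly K x₀)) := by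
    rw [← hev, ← derivative_map, hp₁]
    simp [derivative_mul]
  have hp₁0 : p₁.eval x₀ ≠ 0 := by
    rw [hp₁ev]
    exact hq.separable.aeval_derivative_ne_zero (minpoly.aeval _ _)
  have hh₀0 : aeval x₀ h₀ ≠ 0 := fun h => hqh (minpoly.dvd K x₀ h)
  set s : AlgebraicClosure K := p₁.eval x₀ * aeval x₀ h₀ with hs
  have hs0 : s ≠ 0 := mul_ne_zero hp₁0 hh₀0
  refine ⟨Matrix.of fun i j => aeval x₀ (N i j) / s, ?_, ?_⟩
  · intro i j
    refine ⟨N i j, minpoly K x₀ * h₀, hh0, hGN i j,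
      (N i j).map (algebraMap K (AlgebraicClosure K)),
      p₁ * h₀.map (algebraMap K (AlgebraicClosure K)), ?_, ?_, ?_⟩
    · rw [eval_mul, hev]; exact hs0
    · rw [Polynomial.map_mul, hp₁]; ring
    · rw [eval_mul, hev, hev, Matrix.of_apply]
  · intro μ hμ
    have : Fact (Irreducible (minpoly K x₀)) := ⟨hq⟩
    let ψ : AdjoinRoot (minpoly K x₀) →+* AlgebraicClosure K :=
      AdjoinRoot.lift (algebraMap K (AlgebraicClosure K)) x₀ (minpoly.aeval K x₀)
    let : Algebra (AdjoinRoot (minpoly K x₀)) (AlgebraicClosure K) := ψ.toAlgebra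
    have hψ : ∀ f : K[X], algebraMap (AdjoinRoot (minpoly K x₀)) (AlgebraicClosure K)
        (AdjoinRoot.mk (minpoly K x₀) f) = aeval x₀ f := by
      intro f
      exact AdjoinRoot.lift_mk _ f
    have : IsScalarTower K (AdjoinRoot (minpoly K x₀)) (AlgebraicClosure K) :=
      IsScalarTower.of_algebraMap_eq fun a => by
        have := hψ (C a)
        rw [aeval_C] at this
        exact this.symm
    rw [IsRoot, Matrix.eval_charpoly] at hμ
    obtain ⟨u, hu, hu2⟩ := Matrix.exists_mulVec_eq_zero_iff.2 hμ
    have hν : ((N.map (AdjoinRoot.mk (minpoly K x₀))).map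
        (algebraMap (AdjoinRoot (minpoly K x₀)) (AlgebraicClosure K))).mulVec u =
        (s * μ) • u := by
      rw [Matrix.sub_mulVec, sub_eq_zero] at hu2
      ext1 i
      have h1 := congrFun hu2 i
      rw [Matrix.scalar_apply, Matrix.mulVec_diagonal] at h1
      rw [Pi.smul_apply, smul_eq_mul, mul_assoc, h1]
      simp only [Matrix.mulVec, dotProduct, Matrix.map_apply, Matrix.of_apply, hψ, Finset.mul_sum]
      refine Finset.sum_congr rfl fun j _ => ?_
      field_simp
    obtain ⟨κ, e, hκe, hfin⟩ := eigen_rational D hD dx b hb_li hb _ h₀ hq m hbd N hN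
      (AdjoinRoot.mk (minpoly K x₀)) AdjoinRoot.mk_surjective
      (fun f => AdjoinRoot.mk_eq_zero) (s * μ)
      (IsIntegral.tower_top (R := K) (Algebra.IsIntegral.isIntegral (s * μ))) u hu hν
    rw [hψ, map_mul, map_mul, aeval_C, ← hp₁ev, mul_comm (aeval x₀ h₀), ← hs, mul_comm] at hfin
    have hfin2 := mul_right_cancel₀ hs0 hfin
    have he0 : (0 : ℚ) < e := by exact_mod_cast (Nat.zero_le κ).trans_lt hκe
    refine ⟨(κ : ℚ) / (e : ℚ), by positivity, ?_, ?_⟩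
    · rw [div_lt_one he0]
      exact_mod_cast hκe
    · rw [hfin2]
      simp
end

section
/- Let b^∞_0,…,b^∞_{d_x−1} be an integral basis over K[1/x] and let G^∞ ∈ M_{d_x}(K(x)) be defined by d b^∞_j = Σ_{i=0}^{d_x−1} G^∞_{i+1,j+1} b^∞_i dx. Then the residue matrix of G^∞ dx at x = ∞, namely G^∞_{−1} = −(x·G^∞)|_{x=∞} ∈ M_{d_x}(K) (the value at infinity of −x·G^∞, which is well defined since each entry of x·G^∞ is regular at infinity), has the property that every eigenvalue of G^∞_{−1} in an algebraic closure K̄ of K is a rational number contained in the interval [0,1). -/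
open Polynomial

section LocalPart
open WithZero

theorem loc_core {K L : Type*} [Field K] [Field L] [Algebra K L]
    (v : Valuation L ℤᵐ⁰) (θ : Derivation K L L) (t : L) (ht : θ t = t) (e : ℕ) (he : 1 ≤ e)
    (hvt : v t = exp (-(e : ℤ))) (z : L) (k : ℕ) (hz : v z = exp (-(k : ℤ))) :
    ∃ w, v w = 1 ∧ v ((e : L) * θ z - (k : L) * z) = exp (-(k : ℤ)) * v (θ w) := by
  have ht0 : t ≠ 0 := by
    rintro rfl; rw [map_zero] at hvt; exact exp_ne_zero hvt.symm
  have hz0 : z ≠ 0 := by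
    rintro rfl; rw [map_zero] at hz; exact exp_ne_zero hz.symm
  obtain ⟨e, rfl⟩ : ∃ m, e = m + 1 := ⟨e - 1, by omega⟩
  refine ⟨z ^ (e + 1) / t ^ k, ?_, ?_⟩
  · rw [map_div₀, map_pow, map_pow, hz, hvt, ← exp_nsmul, ← exp_nsmul, ← exp_sub, ← exp_zero]
    congr 1
    simp only [nsmul_eq_mul]; push_cast; ring
  · set w := z ^ (e + 1) / t ^ k with hw
    have h1 : w * t ^ k = z ^ (e + 1) := by rw [hw]; field_simp
    have h2 := congrArg θ h1
    have h3 : t * θ (t ^ k) = (k : L) * t ^ k * t := by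
      rw [Derivation.leibniz_pow, ht]
      rcases k with _ | k
      · simp
      · simp [pow_succ]; ring
    have h3' : θ (t ^ k) = (k : L) * t ^ k := by
      apply mul_left_cancel₀ ht0; rw [h3]; ring
    rw [Derivation.leibniz, h3', Derivation.leibniz_pow] at h2
    simp only [smul_eq_mul, nsmul_eq_mul, Nat.add_sub_cancel] at h2
    have h4 : z ^ e * (((e + 1 : ℕ) : L) * θ z - (k : L) * z) = t ^ k * θ w := by
      have : z ^ e * ((k : L) * z) = k * (w * t ^ k) := by rw [h1]; ring
      rw [mul_sub, this]
      linear_combination -h2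
    have h5 := congrArg v h4
    rw [map_mul, map_mul, map_pow, map_pow, hz, hvt, ← exp_nsmul, ← exp_nsmul] at h5
    have h6 : (exp (e • (-(k : ℤ))) : ℤᵐ⁰) ≠ 0 := exp_ne_zero
    apply mul_left_cancel₀ h6
    rw [h5, ← mul_assoc, ← exp_add]
    congr 2
    simp only [nsmul_eq_mul]; push_cast; ring

/-- one descent step -/
theorem loc_step {K L : Type*} [Field K] [Field L] [Algebra K L]
    (v : Valuation L ℤᵐ⁰) (hK : ∀ c : K, c ≠ 0 → v (algebraMap K L c) = 1) [CharZero K]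
    (θ : Derivation K L L) (t : L) (ht : θ t = t) (e : ℕ) (he : 1 ≤ e)
    (hvt : v t = exp (-(e : ℤ))) (O : Subring L)
    (hfrac : ∀ z, v z ≤ 1 → ∃ a ∈ O, ∃ s ∈ O, v s = 1 ∧ z * s = a)
    (hres : ∀ a ∈ O, ∃ f : K[X], v (aeval a f) < 1 ∧ v (aeval a (derivative f)) = 1)
    (c : ℤ) (hc0 : 0 ≤ c) (hc : ∀ z, v z ≤ 1 → v (θ z) ≤ exp c) :
    ∀ z, v z ≤ 1 → v (θ z) ≤ exp (c - 1) := by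
  have hn : ∀ n : ℕ, n ≠ 0 → v (n : L) = 1 := by
    intro n hn
    rw [← map_natCast (algebraMap K L)]
    exact hK _ (by exact_mod_cast hn)
  have b1 : ∀ z, v z < 1 → v (θ z) ≤ exp (c - 1) := by
    intro z hz
    by_cases hz0 : z = 0
    · simp [hz0]
    have hvz : v z ≠ 0 := by simpa using hz0
    obtain ⟨m, hm⟩ : ∃ m : ℤ, v z = exp m := ⟨log (v z), (exp_log hvz).symm⟩
    have hm1 : m < 0 := by
      rw [hm, ← exp_zero] at hz; exact exp_lt_exp.mp hz
    obtain ⟨k, rfl⟩ : ∃ k : ℕ, m = -(k : ℤ) := ⟨m.natAbs, by omega⟩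
    obtain ⟨w, hw, h⟩ := loc_core v θ t ht e he hvt z k hm
    have h1 : v ((e : L) * θ z) ≤ exp (c - 1) := by
      have : (e : L) * θ z = ((e : L) * θ z - (k : L) * z) + (k : L) * z := by ring
      rw [this]
      refine v.map_add_le ?_ ?_
      · rw [h]
        calc exp (-(k : ℤ)) * v (θ w) ≤ exp (-(k : ℤ)) * exp c := by gcongr; exact hc w hw.le
          _ = exp (-(k : ℤ) + c) := (exp_add _ _).symm
          _ ≤ exp (c - 1) := by rw [exp_le_exp]; omega
      · rw [map_mul, hm, hn k (by omega), one_mul, exp_le_exp]; omega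
    rwa [map_mul, hn e (by omega), one_mul] at h1
  have b2 : ∀ a ∈ O, v (θ a) ≤ exp (c - 1) := by
    intro a ha
    obtain ⟨f, hf, hf'⟩ := hres a ha
    have := b1 _ hf
    rw [Derivation.map_aeval, smul_eq_mul, map_mul, hf', one_mul] at this
    exact this
  intro z hz
  obtain ⟨a, ha, s, hs, hvs, hzs⟩ := hfrac z hz
  have h1 : s * θ z = θ a - z * θ s := by
    rw [← hzs, Derivation.leibniz]; simp
  have h2 : v (s * θ z) ≤ exp (c - 1) := by
    rw [h1]
    refine v.map_sub_le (b2 a ha) ?_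
    rw [map_mul]
    calc v z * v (θ s) ≤ 1 * exp (c - 1) := by gcongr; exact b2 s hs
      _ = _ := one_mul _
  rwa [map_mul, hvs, one_mul] at h2

theorem loc_final {K L : Type*} [Field K] [Field L] [Algebra K L]
    (v : Valuation L ℤᵐ⁰) (hK : ∀ c : K, c ≠ 0 → v (algebraMap K L c) = 1) [CharZero K]
    (θ : Derivation K L L) (t : L) (ht : θ t = t) (e : ℕ) (he : 1 ≤ e)
    (hvt : v t = exp (-(e : ℤ))) (O : Subring L)
    (hfrac : ∀ z, v z ≤ 1 → ∃ a ∈ O, ∃ s ∈ O, v s = 1 ∧ z * s = a)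
    (hres : ∀ a ∈ O, ∃ f : K[X], v (aeval a f) < 1 ∧ v (aeval a (derivative f)) = 1)
    (c : ℕ) (hc : ∀ a ∈ O, v (θ a) ≤ exp (c : ℤ)) :
    ∀ z, v z ≤ 1 → v (θ z) ≤ exp (-1) := by
  have h0 : ∀ z, v z ≤ 1 → v (θ z) ≤ exp (c : ℤ) := by
    intro z hz
    obtain ⟨a, ha, s, hs, hvs, hzs⟩ := hfrac z hz
    have h1 : s * θ z = θ a - z * θ s := by
      rw [← hzs, Derivation.leibniz]; simp
    have h2 : v (s * θ z) ≤ exp (c : ℤ) := by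
      rw [h1]
      refine v.map_sub_le (hc a ha) ?_
      rw [map_mul]
      calc v z * v (θ s) ≤ 1 * exp (c : ℤ) := by gcongr; exact hc s hs
        _ = _ := one_mul _
    rwa [map_mul, hvs, one_mul] at h2
  clear hc
  induction c with
  | zero => simpa using loc_step v hK θ t ht e he hvt O hfrac hres _ le_rfl h0
  | succ n ih =>
    apply ih
    have := loc_step v hK θ t ht e he hvt O hfrac hres _ (by positivity) h0
    simpa using this

/-- the iterated product raises the valuation -/
theorem loc_raise {K L : Type*} [Field K] [Field L] [Algebra K L]
    (v : Valuation L ℤᵐ⁰) (hK : ∀ c : K, c ≠ 0 → v (algebraMap K L c) = 1) [CharZero K]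
    (θ : Derivation K L L) (t : L) (ht : θ t = t) (e : ℕ) (he : 1 ≤ e)
    (hvt : v t = exp (-(e : ℤ)))
    (h : ∀ z, v z ≤ 1 → v (θ z) ≤ exp (-1))
    (m J : ℕ) (hm : 1 ≤ m) (z : L) (hz : v z ^ m ≤ exp (-(J : ℤ))) :
    v (θ z - algebraMap K L ((J : K) / ((m * e : ℕ) : K)) * z) ^ m ≤ exp (-((J + 1 : ℕ) : ℤ)) := by
  have hn : ∀ n : ℕ, n ≠ 0 → v (n : L) = 1 := by
    intro n hn
    rw [← map_natCast (algebraMap K L)]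
    exact hK _ (by exact_mod_cast hn)
  have hK1 : ∀ c : K, v (algebraMap K L c) ≤ 1 := by
    intro c
    by_cases hc : c = 0
    · simp [hc]
    · exact (hK c hc).le
  by_cases hz0 : z = 0
  · simp [hz0]; rw [zero_pow (by omega)]; exact zero_le
  have hvz : v z ≠ 0 := by simpa using hz0
  obtain ⟨l, hl⟩ : ∃ m : ℤ, v z = exp m := ⟨log (v z), (exp_log hvz).symm⟩
  rw [hl, ← exp_nsmul, exp_le_exp, nsmul_eq_mul] at hz
  obtain ⟨k, rfl⟩ : ∃ k : ℕ, l = -(k : ℤ) := ⟨l.natAbs, by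
    have : l ≤ 0 := by
      by_contra hcon
      have : (0 : ℤ) < m * l := mul_pos (by exact_mod_cast hm) (by omega)
      omega
    omega⟩
  obtain ⟨w, hw, hwz⟩ := loc_core v θ t ht e he hvt z k hl
  have h1 : v ((e : L) * θ z - (k : L) * z) ≤ exp (-((k : ℤ) + 1)) := by
    rw [hwz]
    calc _ ≤ exp (-(k : ℤ)) * exp (-1) := by gcongr; exact h w hw.le
      _ = _ := by rw [← exp_add]; congr 1; ring
  have heL : (e : L) ≠ 0 := by
    intro h0; have := hn e (by omega); rw [h0] at this; simp at this
  have hmK : (m : K) ≠ 0 := by exact_mod_cast (by omega : m ≠ 0)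
  have heK : (e : K) ≠ 0 := by exact_mod_cast (by omega : e ≠ 0)
  have h2 : v (θ z - algebraMap K L ((k : K) / (e : K)) * z) ≤ exp (-((k : ℤ) + 1)) := by
    have : (e : L) * θ z - (k : L) * z = (e : L) * (θ z - algebraMap K L ((k : K) / (e : K)) * z) := by
      rw [map_div₀, map_natCast, map_natCast]; field_simp
    rw [this, map_mul, hn e (by omega), one_mul] at h1
    exact h1
  have hz' : (J : ℤ) ≤ m * k := by linarith
  rcases hz'.lt_or_eq with hlt | heq
  · have h3 : v (θ z - algebraMap K L ((J : K) / ((m * e : ℕ) : K)) * z) ≤ exp (-(k : ℤ)) := by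
      have : θ z - algebraMap K L ((J : K) / ((m * e : ℕ) : K)) * z =
        (θ z - algebraMap K L ((k : K) / (e : K)) * z) +
          algebraMap K L ((k : K) / (e : K) - (J : K) / ((m * e : ℕ) : K)) * z := by
        rw [map_sub]; ring
      rw [this]
      refine v.map_add_le (h2.trans (by rw [exp_le_exp]; omega)) ?_
      rw [map_mul, hl]
      calc _ ≤ 1 * exp (-(k : ℤ)) := by gcongr; exact hK1 _
        _ = _ := one_mul _
    calc _ ≤ exp (-(k : ℤ)) ^ m := pow_le_pow_left₀ zero_le h3 m
      _ ≤ _ := by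
        rw [← exp_nsmul, exp_le_exp, nsmul_eq_mul]; push_cast; linarith
  · have : (J : K) / ((m * e : ℕ) : K) = (k : K) / (e : K) := by
      have : (J : K) = m * k := by exact_mod_cast heq
      rw [this]; push_cast; field_simp
    rw [this]
    calc _ ≤ exp (-((k : ℤ) + 1)) ^ m := pow_le_pow_left₀ zero_le h2 m
      _ ≤ _ := by
        rw [← exp_nsmul, exp_le_exp, nsmul_eq_mul]; push_cast
        have : (1 : ℤ) ≤ m := by exact_mod_cast hm
        linarith
end LocalPart
section GlobalPart
open WithZero IsDedekindDomain

variable {K F L : Type*} [Field K] [CharZero K] [Field F] [Field L] [Algebra K[X] F]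
  [IsFractionRing K[X] F] [Algebra K[X] L] [Algebra F L] [IsScalarTower K[X] F L] [Algebra K L]
  [IsScalarTower K K[X] L] [FiniteDimensional F L]

theorem residue_poly {K O : Type*} [Field K] [CharZero K] [CommRing O] [Algebra K[X] O] [Algebra K O]
    [IsScalarTower K K[X] O] [Algebra.IsIntegral K[X] O] (P : Ideal O) [P.IsPrime]
    (hP : algebraMap K[X] O X ∈ P) (a : O) :
    ∃ f : K[X], aeval a f ∈ P ∧ aeval a (derivative f) ∉ P := by
  have hcomp : (algebraMap K[X] (O ⧸ P)) = (algebraMap K (O ⧸ P)).comp (evalRingHom 0) := by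
    apply Polynomial.ringHom_ext
    · intro c
      simp only [RingHom.comp_apply, coe_evalRingHom, eval_C]
      rw [IsScalarTower.algebraMap_apply K K[X] (O ⧸ P)]; rfl
    · simp only [RingHom.comp_apply, coe_evalRingHom, eval_X, map_zero]
      rw [IsScalarTower.algebraMap_apply K[X] O (O ⧸ P)]
      exact Ideal.Quotient.eq_zero_iff_mem.mpr hP
  have hint : IsIntegral K (Ideal.Quotient.mk P a) := by
    obtain ⟨p, hp, hpa⟩ := Algebra.IsIntegral.isIntegral (R := K[X]) a
    refine ⟨p.map (evalRingHom 0), hp.map _, ?_⟩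
    rw [eval₂_map, ← hcomp, IsScalarTower.algebraMap_eq K[X] O (O ⧸ P)]
    have := congrArg (Ideal.Quotient.mk P) hpa
    rw [hom_eval₂, map_zero] at this
    exact this
  have hmk : ∀ f : K[X], Ideal.Quotient.mk P (aeval a f) = aeval (Ideal.Quotient.mk P a) f := by
    intro f
    exact (aeval_algHom_apply (Ideal.Quotient.mkₐ K P) a f).symm
  refine ⟨minpoly K (Ideal.Quotient.mk P a), ?_, ?_⟩
  · rw [← Ideal.Quotient.eq_zero_iff_mem, hmk, minpoly.aeval]
  · rw [← Ideal.Quotient.eq_zero_iff_mem, hmk]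
    exact (minpoly.irreducible hint).separable.aeval_derivative_ne_zero (minpoly.aeval _ _)

theorem place_bound {n : ℕ} (b : Fin n → L)
    [IsDedekindDomain (integralClosure K[X] L)] [IsFractionRing (integralClosure K[X] L) L]
    (hint : ∀ z, (∃ c : Fin n → K[X], z = ∑ i, algebraMap K[X] L (c i) * b i) ↔ IsIntegral K[X] z)
    (θ : Derivation K L L) (hθ : θ (algebraMap K[X] L X) = algebraMap K[X] L X)
    (P : HeightOneSpectrum (integralClosure K[X] L))
    (hP : algebraMap K[X] (integralClosure K[X] L) X ∈ P.asIdeal) (hX : algebraMap K[X] L X ≠ 0) :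
    (∀ c : K, c ≠ 0 → P.valuation L (algebraMap K L c) = 1) ∧
    ∃ e : ℕ, 1 ≤ e ∧ P.valuation L (algebraMap K[X] L X) = exp (-(e : ℤ)) ∧
      ∀ z, P.valuation L z ≤ 1 → P.valuation L (θ z) ≤ exp (-1) := by
  set v := P.valuation L with hv
  have hle : ∀ z, IsIntegral K[X] z → v z ≤ 1 := fun z hz =>
    P.valuation_le_one (K := L) (⟨z, hz⟩ : integralClosure K[X] L)
  have hpoly : ∀ p : K[X], v (algebraMap K[X] L p) ≤ 1 := fun p => hle _ isIntegral_algebraMap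
  have hKle : ∀ c : K, v (algebraMap K L c) ≤ 1 := fun c => by
    rw [IsScalarTower.algebraMap_apply K K[X] L]; exact hpoly _
  have hK : ∀ c : K, c ≠ 0 → v (algebraMap K L c) = 1 := by
    intro c hc
    apply le_antisymm (hKle c)
    have h1 : v (algebraMap K L c) * v (algebraMap K L c⁻¹) = 1 := by
      rw [← map_mul, ← map_mul, mul_inv_cancel₀ hc]; simp
    calc (1 : ℤᵐ⁰) = v (algebraMap K L c) * v (algebraMap K L c⁻¹) := h1.symm
      _ ≤ v (algebraMap K L c) * 1 := by gcongr; exact hKle _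
      _ = _ := mul_one _
  refine ⟨hK, ?_⟩
  have hlt : v (algebraMap K[X] L X) < 1 := by
    have := (P.valuation_lt_one_iff_mem (K := L) _).mpr hP
    exact this
  have hvX : v (algebraMap K[X] L X) ≠ 0 := by simpa using hX
  obtain ⟨m, hm⟩ : ∃ m : ℤ, v (algebraMap K[X] L X) = exp m := ⟨log _, (exp_log hvX).symm⟩
  have hm1 : m < 0 := by
    rw [hm, ← exp_zero] at hlt; exact exp_lt_exp.mp hlt
  obtain ⟨e, rfl⟩ : ∃ k : ℕ, m = -(k : ℤ) := ⟨m.natAbs, by omega⟩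
  refine ⟨e, by omega, hm, ?_⟩
  -- bound on the integral closure
  have hθp : ∀ p : K[X], v (θ (algebraMap K[X] L p)) ≤ 1 := by
    intro p
    have h1 : ∀ p : K[X], algebraMap K[X] L p = aeval (algebraMap K[X] L X) p := by
      intro p
      rw [aeval_algebraMap_apply, aeval_X_left_apply]
    rw [h1 p, Derivation.map_aeval, hθ, smul_eq_mul, ← h1, map_mul]
    exact mul_le_one' (hpoly _) (hpoly _)
  obtain ⟨c, hc⟩ : ∃ c : ℕ, ∀ i, v (b i) ≤ exp (c : ℤ) ∧ v (θ (b i)) ≤ exp (c : ℤ) := by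
    have key : ∀ x : ℤᵐ⁰, ∃ c : ℕ, x ≤ exp (c : ℤ) := by
      intro x
      by_cases hx : x = 0
      · exact ⟨0, by simp [hx]⟩
      · refine ⟨(log x).natAbs, ?_⟩
        conv_lhs => rw [← exp_log hx]
        rw [exp_le_exp]; omega
    choose f hf using key
    refine ⟨∑ i, (f (v (b i)) + f (v (θ (b i)))), fun i => ?_⟩
    have h1 := Finset.single_le_sum (f := fun i => (f (v (b i)) + f (v (θ (b i)))))
      (fun _ _ => Nat.zero_le _) (Finset.mem_univ i)
    exact ⟨(hf _).trans (by rw [exp_le_exp]; omega), (hf _).trans (by rw [exp_le_exp]; omega)⟩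
  refine loc_final v hK θ _ hθ e (by omega) hm (integralClosure K[X] L).toSubring ?_ ?_ c ?_
  · intro z hz
    obtain ⟨a, d, had⟩ := P.exists_primeCompl_mul_eq_of_integer z hz
    refine ⟨a, a.2, d.1, d.1.2, ?_, had⟩
    exact (P.valuation_eq_one_iff_notMem (K := L)).mpr d.2
  · intro a ha
    obtain ⟨f, hf, hf'⟩ := residue_poly P.asIdeal hP (⟨a, ha⟩ : integralClosure K[X] L)
    have hh : ∀ f : K[X], aeval a f = algebraMap (integralClosure K[X] L) L
        (aeval (⟨a, ha⟩ : integralClosure K[X] L) f) := fun f => by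
      rw [← aeval_algebraMap_apply]; rfl
    refine ⟨f, ?_, ?_⟩
    · rw [hh]; exact (P.valuation_lt_one_iff_mem (K := L) _).mpr hf
    · rw [hh]; exact (P.valuation_eq_one_iff_notMem (K := L)).mpr hf'
  · intro a ha
    obtain ⟨p, rfl⟩ := (hint a).mpr ha
    rw [map_sum]
    refine v.map_sum_le fun i _ => ?_
    rw [Derivation.leibniz, smul_eq_mul, smul_eq_mul]
    refine v.map_add_le ?_ ?_
    · rw [map_mul]
      calc _ ≤ 1 * exp (c : ℤ) := by gcongr; exacts [hpoly _, (hc i).2]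
        _ = _ := one_mul _
    · rw [map_mul]
      calc _ ≤ exp (c : ℤ) * 1 := by gcongr; exacts [(hc i).1, hθp _]
        _ = _ := mul_one _

theorem exists_denom [IsDedekindDomain (integralClosure K[X] L)] [IsFractionRing (integralClosure K[X] L) L]
    [Algebra.IsAlgebraic K[X] L]
    (z : L) (hz : ∀ P : HeightOneSpectrum (integralClosure K[X] L),
      algebraMap K[X] (integralClosure K[X] L) X ∈ P.asIdeal → P.valuation L z ≤ 1) :
    ∃ s : K[X], s.eval 0 ≠ 0 ∧ IsIntegral K[X] (algebraMap K[X] L s * z) := by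
  obtain ⟨y, hy, hyz⟩ := (Algebra.IsAlgebraic.isAlgebraic (R := K[X]) z).exists_integral_multiple
  obtain ⟨s, hs, hs'⟩ := Polynomial.exists_eq_pow_rootMultiplicity_mul_and_not_dvd y hy 0
  refine ⟨s, fun h => hs' (dvd_iff_isRoot.mpr h), ?_⟩
  have : algebraMap K[X] L s * z ∈ (algebraMap (integralClosure K[X] L) L).range := by
    apply HeightOneSpectrum.mem_integers_of_valuation_le_one
    intro P
    by_cases hP : algebraMap K[X] (integralClosure K[X] L) X ∈ P.asIdeal
    · rw [map_mul]
      refine mul_le_one' ?_ (hz P hP)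
      exact P.valuation_le_one (K := L) (algebraMap K[X] (integralClosure K[X] L) s)
    · have h1 : P.valuation L (algebraMap K[X] L X) = 1 :=
        (P.valuation_eq_one_iff_notMem (K := L)).mpr hP
      have h2 := P.valuation_le_one (K := L) (⟨_, hyz⟩ : integralClosure K[X] L)
      have h3 : P.valuation L (y • z) ≤ 1 := h2
      rw [Algebra.smul_def, map_mul, hs, map_mul, map_pow, C_0, sub_zero, map_mul, map_pow, h1,
        one_pow, one_mul] at h3
      rw [map_mul]; exact h3
  obtain ⟨w, hw⟩ := this
  rw [← hw]; exact w.2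
end GlobalPart
section CorePart
open WithZero IsDedekindDomain

theorem core_alg {K F L : Type*} [Field K] [CharZero K] [Field F] [Field L] [Algebra K[X] F]
    [IsFractionRing K[X] F] [Algebra K[X] L] [Algebra F L] [IsScalarTower K[X] F L] [Algebra K L]
    [IsScalarTower K K[X] L] [FiniteDimensional F L] {n : ℕ} (b : Fin n → L)
    (hli : LinearIndependent F b)
    (hint : ∀ z, (∃ c : Fin n → K[X], z = ∑ i, algebraMap K[X] L (c i) * b i) ↔ IsIntegral K[X] z)
    (θ : Derivation K L L) (hθ : θ (algebraMap K[X] L X) = algebraMap K[X] L X)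
    (N : Matrix (Fin n) (Fin n) F) (hN : ∀ j, θ (b j) = ∑ i, algebraMap F L (N i j) * b i) :
    ∃ M : Matrix (Fin n) (Fin n) K,
      (∀ i j, ∃ g h : K[X], h.eval 0 ≠ 0 ∧ N i j * algebraMap K[X] F h = algebraMap K[X] F g ∧
        M i j = g.eval 0 / h.eval 0) ∧
      ∃ E : ℕ, 1 ≤ E ∧ aeval M (∏ J ∈ Finset.range E, (X - C ((J : K) / (E : K)))) = 0 := by
  have : CharZero K[X] := inferInstance
  have : CharZero F := charZero_of_injective_algebraMap (IsFractionRing.injective K[X] F)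
  have : IsDedekindDomain (integralClosure K[X] L) := integralClosure.isDedekindDomain K[X] F L
  have : IsFractionRing (integralClosure K[X] L) L :=
    integralClosure.isFractionRing_of_finite_extension F L
  have : Algebra.IsAlgebraic F L := inferInstance
  have : Algebra.IsAlgebraic K[X] L := (IsFractionRing.comap_isAlgebraic_iff (K := F)).mpr inferInstance
  have hinjL : Function.Injective (algebraMap K[X] L) := by
    rw [IsScalarTower.algebraMap_eq K[X] F L]
    exact (algebraMap F L).injective.comp (IsFractionRing.injective K[X] F)
  have hX : algebraMap K[X] L X ≠ 0 := by
    rw [Ne, map_eq_zero_iff _ hinjL]; exact X_ne_zero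
  have hliF : ∀ p q : Fin n → F, ∑ i, algebraMap F L (p i) * b i = ∑ i, algebraMap F L (q i) * b i →
      p = q := by
    intro p q h
    have h1 := Fintype.linearIndependent_iff.mp hli (p - q) (by
      simp only [Pi.sub_apply, Algebra.smul_def, map_sub, sub_mul, Finset.sum_sub_distrib]
      rw [h, sub_self])
    funext i
    exact sub_eq_zero.mp (h1 i)
  have hpl := fun P hP => place_bound b hint θ hθ P hP hX
  choose hK e he hve hθv using hpl
  set T := algebraMap K[X] L X with hT
  -- the entries of N are regular
  have hreg : ∀ i j, ∃ g h : K[X], h.eval 0 ≠ 0 ∧ N i j * algebraMap K[X] F h = algebraMap K[X] F g := by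
    intro i j
    have hbint : ∀ P : HeightOneSpectrum (integralClosure K[X] L), P.valuation L (b j) ≤ 1 := by
      intro P
      have : IsIntegral K[X] (b j) := (hint _).mp ⟨Pi.single j 1, by
        simp [Pi.single_apply]⟩
      exact P.valuation_le_one (K := L) (⟨_, this⟩ : integralClosure K[X] L)
    obtain ⟨s, hs, hsz⟩ := exists_denom (θ (b j)) (fun P hP =>
      (hθv P hP _ (hbint P)).trans (by rw [← exp_zero, exp_le_exp]; norm_num))
    obtain ⟨c, hc⟩ := (hint _).mpr hsz
    refine ⟨c i, s, hs, ?_⟩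
    have := hliF (fun i => N i j * algebraMap K[X] F s) (fun i => algebraMap K[X] F (c i)) (by
      simp only [map_mul, ← IsScalarTower.algebraMap_apply K[X] F L]
      rw [← hc, hN, Finset.mul_sum]
      exact Finset.sum_congr rfl fun i _ => by ring)
    exact congrFun this i
  choose g h hh hgh using hreg
  let M : Matrix (Fin n) (Fin n) K := fun i j => (g i j).eval 0 / (h i j).eval 0
  refine ⟨M, fun i j => ⟨g i j, h i j, hh i j, hgh i j, rfl⟩, ?_⟩
  have hbint : ∀ (P : HeightOneSpectrum (integralClosure K[X] L)) j, P.valuation L (b j) ≤ 1 := by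
    intro P j
    have : IsIntegral K[X] (b j) := (hint _).mp ⟨Pi.single j 1, by
      simp [Pi.single_apply]⟩
    exact P.valuation_le_one (K := L) (⟨_, this⟩ : integralClosure K[X] L)
  have hpoly : ∀ (P : HeightOneSpectrum (integralClosure K[X] L)) p,
      P.valuation L (algebraMap K[X] L p) ≤ 1 := fun P p =>
    P.valuation_le_one (K := L) (algebraMap K[X] (integralClosure K[X] L) p)
  have hKle : ∀ (P : HeightOneSpectrum (integralClosure K[X] L)) (c : K),
      P.valuation L (algebraMap K L c) ≤ 1 := fun P c => by
    rw [IsScalarTower.algebraMap_apply K K[X] L]; exact hpoly P _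
  have hXmul : ∀ (P : HeightOneSpectrum (integralClosure K[X] L)) (p : K[X]), p.eval 0 = 0 →
      P.valuation L (algebraMap K[X] L p) ≤ P.valuation L T := by
    intro P p hp
    obtain ⟨r, rfl⟩ : X ∣ p := X_dvd_iff.mpr (by rwa [coeff_zero_eq_eval_zero])
    rw [map_mul, map_mul]
    exact mul_le_of_le_one_right' (hpoly P r)
  have hTlt : ∀ (P : HeightOneSpectrum (integralClosure K[X] L)),
      algebraMap K[X] (integralClosure K[X] L) X ∈ P.asIdeal → P.valuation L T < 1 := by
    intro P hP
    rw [hve P hP, ← exp_zero, exp_lt_exp]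
    have := he P hP
    omega
  have hNM : ∀ (P : HeightOneSpectrum (integralClosure K[X] L)),
      algebraMap K[X] (integralClosure K[X] L) X ∈ P.asIdeal → ∀ i j,
      P.valuation L (algebraMap F L (N i j) - algebraMap K L (M i j)) ≤ P.valuation L T := by
    intro P hP i j
    have hv1 : P.valuation L (algebraMap K[X] L (h i j)) = 1 := by
      apply le_antisymm (hpoly P _)
      by_contra hcon
      rw [not_le] at hcon
      have h1 := hXmul P (C ((h i j).eval 0) - h i j) (by simp)
      have h2 : P.valuation L (algebraMap K L ((h i j).eval 0)) < 1 := by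
        have : algebraMap K L ((h i j).eval 0) =
          algebraMap K[X] L (C ((h i j).eval 0) - h i j) + algebraMap K[X] L (h i j) := by
          rw [← map_add, sub_add_cancel, IsScalarTower.algebraMap_apply K K[X] L]; rfl
        rw [this]
        exact (P.valuation L).map_add_lt (h1.trans_lt (hTlt P hP)) hcon
      rw [hK P hP _ (hh i j)] at h2
      exact lt_irrefl _ h2
    have h3 := hXmul P (g i j - C (M i j) * h i j) (by
      simp only [eval_sub, eval_mul, eval_C, M]
      rw [div_mul_cancel₀ _ (hh i j), sub_self])
    have h4 : algebraMap K[X] L (g i j - C (M i j) * h i j) =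
        (algebraMap F L (N i j) - algebraMap K L (M i j)) * algebraMap K[X] L (h i j) := by
      rw [map_sub, map_mul, IsScalarTower.algebraMap_apply K[X] F L (g i j), ← hgh, map_mul,
        ← IsScalarTower.algebraMap_apply K[X] F L, IsScalarTower.algebraMap_apply K K[X] L, sub_mul]
      rfl
    rwa [h4, map_mul, hv1, mul_one] at h3
  let ι : (Fin n → K) → L := fun c => ∑ i, algebraMap K L (c i) * b i
  have hιθ : ∀ (P : HeightOneSpectrum (integralClosure K[X] L)),
      algebraMap K[X] (integralClosure K[X] L) X ∈ P.asIdeal → ∀ c,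
      P.valuation L (θ (ι c) - ι (M.mulVec c)) ≤ P.valuation L T := by
    intro P hP c
    have h1 : θ (ι c) - ι (M.mulVec c) = ∑ j, ∑ i,
        algebraMap K L (c j) * ((algebraMap F L (N i j) - algebraMap K L (M i j)) * b i) := by
      have h2 : ι (M.mulVec c) = ∑ j, ∑ i, algebraMap K L (c j) * (algebraMap K L (M i j) * b i) := by
        simp only [ι, Matrix.mulVec, dotProduct, map_sum, map_mul]
        rw [Finset.sum_comm]
        refine Finset.sum_congr rfl fun i _ => ?_
        rw [Finset.sum_mul]
        exact Finset.sum_congr rfl fun j _ => by ring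
      have h3 : θ (ι c) = ∑ j, ∑ i, algebraMap K L (c j) * (algebraMap F L (N i j) * b i) := by
        simp only [ι, map_sum]
        refine Finset.sum_congr rfl fun j _ => ?_
        rw [Derivation.leibniz, Derivation.map_algebraMap, smul_zero, add_zero, smul_eq_mul, hN,
          Finset.mul_sum]
      rw [h2, h3, ← Finset.sum_sub_distrib]
      refine Finset.sum_congr rfl fun j _ => ?_
      rw [← Finset.sum_sub_distrib]
      exact Finset.sum_congr rfl fun i _ => by ring
    rw [h1]
    refine (P.valuation L).map_sum_le fun j _ => (P.valuation L).map_sum_le fun i _ => ?_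
    rw [map_mul, map_mul]
    refine (mul_le_of_le_one_left' (hKle P _)).trans ((mul_le_of_le_one_right' (hbint P i)).trans
      (hNM P hP i j))
  -- stability of the ideal generated by T
  have hTst : ∀ (P : HeightOneSpectrum (integralClosure K[X] L)),
      algebraMap K[X] (integralClosure K[X] L) X ∈ P.asIdeal → ∀ w,
      P.valuation L w ≤ P.valuation L T → P.valuation L (θ w) ≤ P.valuation L T := by
    intro P hP w hw
    obtain ⟨u, rfl⟩ : ∃ u, w = T * u := ⟨w / T, by field_simp⟩
    have hu : P.valuation L u ≤ 1 := by
      rw [map_mul] at hw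
      have h0 : 0 < P.valuation L T := by
        rw [hve P hP]; exact exp_pos
      exact (mul_le_iff_le_one_right h0).mp hw
    rw [Derivation.leibniz, hθ, smul_eq_mul, smul_eq_mul]
    refine (P.valuation L).map_add_le ?_ ?_
    · rw [map_mul]
      exact mul_le_of_le_one_right' ((hθv P hP u hu).trans (by rw [← exp_zero, exp_le_exp]; norm_num))
    · rw [map_mul]
      exact mul_le_of_le_one_left' hu
  let θL : Module.End K L := θ.toLinearMap
  have hθL : ∀ z, θL z = θ z := fun z => rfl
  have hB : ∀ (P : HeightOneSpectrum (integralClosure K[X] L)),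
      algebraMap K[X] (integralClosure K[X] L) X ∈ P.asIdeal → ∀ (q : K[X]) c,
      P.valuation L (aeval θL q (ι c) - ι ((aeval M q).mulVec c)) ≤ P.valuation L T := by
    intro P hP q c
    have hadd : ∀ c d, ι (c + d) = ι c + ι d := by
      intro c d
      simp [ι, add_mul, Finset.sum_add_distrib]
    have hsmul : ∀ (a : K) c, ι (a • c) = a • ι c := by
      intro a c
      rw [Algebra.smul_def a (ι c)]
      simp only [ι, Pi.smul_apply, smul_eq_mul, map_mul, Finset.mul_sum, mul_assoc]
    induction q using Polynomial.induction_on with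
    | C a =>
      have : aeval θL (C a) (ι c) - ι ((aeval M (C a)).mulVec c) = 0 := by
        rw [aeval_C, aeval_C, Module.algebraMap_end_apply, Algebra.algebraMap_eq_smul_one,
          Matrix.smul_mulVec, Matrix.one_mulVec, hsmul, sub_self]
      rw [this, map_zero]; exact zero_le
    | add p q hp hq =>
      have : aeval θL (p + q) (ι c) - ι ((aeval M (p + q)).mulVec c) =
        (aeval θL p (ι c) - ι ((aeval M p).mulVec c)) +
        (aeval θL q (ι c) - ι ((aeval M q).mulVec c)) := by
        rw [map_add, map_add, LinearMap.add_apply, Matrix.add_mulVec, hadd]; ring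
      rw [this]
      exact (P.valuation L).map_add_le hp hq
    | monomial k a hq =>
      have e1 : (C a * X ^ (k + 1) : K[X]) = X * (C a * X ^ k) := by ring
      rw [e1]
      generalize (C a * X ^ k : K[X]) = q at hq
      have : aeval θL (X * q) (ι c) - ι ((aeval M (X * q)).mulVec c) =
        θ (aeval θL q (ι c) - ι ((aeval M q).mulVec c)) +
        (θ (ι ((aeval M q).mulVec c)) - ι (M.mulVec ((aeval M q).mulVec c))) := by
        rw [map_mul, map_mul, aeval_X, aeval_X, Module.End.mul_apply, hθL, map_sub,
          Matrix.mulVec_mulVec]; ring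
      rw [this]
      exact (P.valuation L).map_add_le (hTst P hP _ hq) (hιθ P hP _)
  -- the common multiple
  have hfin : {P : HeightOneSpectrum (integralClosure K[X] L) |
      algebraMap K[X] (integralClosure K[X] L) X ∈ P.asIdeal}.Finite := by
    have hne : Ideal.span {algebraMap K[X] (integralClosure K[X] L) X} ≠ 0 := by
      rw [Ne, Ideal.zero_eq_bot, Ideal.span_singleton_eq_bot]
      intro h0
      apply hX
      have := congrArg (algebraMap (integralClosure K[X] L) L) h0
      rw [map_zero] at this
      exact this
    have := Ideal.finite_factors hne
    simpa only [Ideal.dvd_span_singleton] using this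
  have : Fintype {P : HeightOneSpectrum (integralClosure K[X] L) //
      algebraMap K[X] (integralClosure K[X] L) X ∈ P.asIdeal} := hfin.fintype
  let E : ℕ := ∏ P : {P : HeightOneSpectrum (integralClosure K[X] L) //
      algebraMap K[X] (integralClosure K[X] L) X ∈ P.asIdeal}, e P.1 P.2
  have hE1 : 1 ≤ E := Nat.succ_le_of_lt (Finset.prod_pos (fun P _ => he P.1 P.2))
  refine ⟨E, hE1, ?_⟩
  have hA : ∀ (P : HeightOneSpectrum (integralClosure K[X] L)),
      algebraMap K[X] (integralClosure K[X] L) X ∈ P.asIdeal → ∀ z, P.valuation L z ≤ 1 →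
      P.valuation L (aeval θL (∏ J ∈ Finset.range E, (X - C ((J : K) / (E : K)))) z) ≤
        P.valuation L T := by
    intro P hP z hz
    obtain ⟨m, hm⟩ : e P hP ∣ E := Finset.dvd_prod_of_mem (fun P : {P : HeightOneSpectrum
      (integralClosure K[X] L) // algebraMap K[X] (integralClosure K[X] L) X ∈ P.asIdeal} => e P.1 P.2)
      (Finset.mem_univ ⟨P, hP⟩)
    have hm1 : 1 ≤ m := by
      rcases m with _ | m
      · simp at hm; omega
      · omega
    have hstep : ∀ J : ℕ, P.valuation L
        (aeval θL (∏ j ∈ Finset.range J, (X - C ((j : K) / (E : K)))) z) ^ m ≤ exp (-(J : ℤ)) := by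
      intro J
      induction J with
      | zero => simpa using pow_le_one' hz m
      | succ J ih =>
        have := loc_raise (P.valuation L) (hK P hP) θ T hθ (e P hP) (he P hP) (hve P hP) (hθv P hP)
          m J hm1 _ ih
        rw [Finset.prod_range_succ, mul_comm, map_mul, Module.End.mul_apply]
        rw [map_sub, aeval_X, aeval_C, LinearMap.sub_apply, Module.algebraMap_end_apply, hθL,
          Algebra.smul_def, hm, mul_comm (e P hP) m]
        rw [hm, mul_comm (e P hP) m] at this
        exact this
    have h1 := hstep E
    have h2 : (exp (-(E : ℤ)) : ℤᵐ⁰) = (P.valuation L T) ^ m := by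
      rw [hve P hP, ← exp_nsmul, hm]; congr 1; simp only [nsmul_eq_mul]; push_cast; ring
    rw [h2] at h1
    exact (pow_le_pow_iff_left₀ zero_le zero_le (by omega)).mp h1
  set p : K[X] := ∏ J ∈ Finset.range E, (X - C ((J : K) / (E : K)))
  have hι1 : ∀ (P : HeightOneSpectrum (integralClosure K[X] L)) c, P.valuation L (ι c) ≤ 1 := by
    intro P c
    refine (P.valuation L).map_sum_le fun i _ => ?_
    rw [map_mul]
    exact mul_le_one' (hKle P _) (hbint P i)
  have hzero : ∀ c, (aeval M p).mulVec c = 0 := by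
    intro c
    set d := (aeval M p).mulVec c with hd
    have h1 : ∀ (P : HeightOneSpectrum (integralClosure K[X] L)),
      algebraMap K[X] (integralClosure K[X] L) X ∈ P.asIdeal → P.valuation L (ι d / T) ≤ 1 := by
      intro P hP
      have h2 : P.valuation L (ι d) ≤ P.valuation L T := by
        have : ι d = aeval θL p (ι c) - (aeval θL p (ι c) - ι d) := by ring
        rw [this]
        exact (P.valuation L).map_sub_le (hA P hP _ (hι1 P c)) (hB P hP p c)
      rw [map_div₀]
      exact div_le_one_of_le₀ h2 zero_le
    obtain ⟨s, hs, hsz⟩ := exists_denom _ h1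
    obtain ⟨r, hr⟩ := (hint _).mpr hsz
    have h3 := hliF (fun i => algebraMap K[X] F (s * C (d i))) (fun i => algebraMap K[X] F (X * r i)) (by
      simp only [← IsScalarTower.algebraMap_apply K[X] F L, map_mul, mul_assoc, ← Finset.mul_sum]
      rw [← hr, ← hT]
      have : ∑ i, algebraMap K[X] L (C (d i)) * b i = ι d := by
        simp only [ι, IsScalarTower.algebraMap_apply K K[X] L]; rfl
      rw [this]; field_simp)
    funext i
    have h4 := IsFractionRing.injective K[X] F (congrFun h3 i)
    have h5 := congrArg (eval 0) h4
    simp only [eval_mul, eval_C, eval_X, zero_mul] at h5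
    exact (mul_eq_zero.mp h5).resolve_left hs
  apply Matrix.ext_of_mulVec_single
  intro i
  rw [hzero, Matrix.zero_mulVec]
end CorePart

open scoped TensorProduct in
theorem exists_deriv {K L : Type*} [Field K] [CharZero K]
    [Field L] [Algebra (RatFunc K) L] [Algebra K L] [IsScalarTower K (RatFunc K) L]
    [FiniteDimensional (RatFunc K) L] :
    ∃ ℓ : Ω[L⁄K] →ₗ[L] L, ℓ (KaehlerDifferential.D K L (algebraMap (RatFunc K) L RatFunc.X)) = 1 := by
  let : Algebra K[X] L := ((algebraMap (RatFunc K) L).comp (algebraMap K[X] (RatFunc K))).toAlgebra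
  have : IsScalarTower K[X] (RatFunc K) L := IsScalarTower.of_algebraMap_eq fun _ => rfl
  have : IsScalarTower K K[X] L := IsScalarTower.of_algebraMap_eq fun a => by
    rw [IsScalarTower.algebraMap_apply K (RatFunc K) L, IsScalarTower.algebraMap_apply K[X] (RatFunc K) L,
      IsScalarTower.algebraMap_apply K K[X] (RatFunc K)]
  have : Algebra.FormallyEtale K[X] (RatFunc K) :=
    Algebra.FormallyEtale.of_isLocalization (nonZeroDivisors K[X])
  have : CharZero (RatFunc K) := charZero_of_injective_algebraMap (algebraMap K (RatFunc K)).injective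
  have : Algebra.FormallyEtale (RatFunc K) L := Algebra.FormallyEtale.of_isSeparable _ _
  have : Algebra.FormallyEtale K[X] L := Algebra.FormallyEtale.comp K[X] (RatFunc K) L
  let φ := (KaehlerDifferential.tensorKaehlerEquivOfFormallyEtale K K[X] L).symm
  let ψ : L ⊗[K[X]] Ω[K[X]⁄K] →ₗ[L] L :=
    (TensorProduct.AlgebraTensorModule.rid K[X] L L).toLinearMap ∘ₗ
      (TensorProduct.AlgebraTensorModule.map (LinearMap.id) (KaehlerDifferential.polynomialEquiv K).toLinearMap)
  refine ⟨ψ ∘ₗ φ.toLinearMap, ?_⟩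
  have : algebraMap (RatFunc K) L RatFunc.X = algebraMap K[X] L X := by
    rw [IsScalarTower.algebraMap_apply K[X] (RatFunc K) L, RatFunc.algebraMap_X]
  rw [this]
  simp only [LinearMap.comp_apply, LinearEquiv.coe_coe, φ]
  rw [KaehlerDifferential.tensorKaehlerEquivOfFormallyEtale_symm_D_algebraMap]
  simp [ψ]
  try simp [KaehlerDifferential.polynomialEquiv]

theorem fracRing_inv {K : Type*} [Field K] :
    Function.Injective (aeval ((RatFunc.X : RatFunc K)⁻¹) : K[X] →ₐ[K] RatFunc K) ∧
    ∀ f : RatFunc K, ∃ g h : K[X], h ≠ 0 ∧ f * aeval ((RatFunc.X : RatFunc K)⁻¹) h = aeval ((RatFunc.X : RatFunc K)⁻¹) g := by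
  have hX : (RatFunc.X : RatFunc K) ≠ 0 := RatFunc.X_ne_zero
  let : Invertible (RatFunc.X : RatFunc K) := invertibleOfNonzero hX
  have key : ∀ (N : ℕ) (f : K[X]), f.natDegree ≤ N →
      aeval ((RatFunc.X : RatFunc K)⁻¹) (reflect N f) * RatFunc.X ^ N = algebraMap K[X] (RatFunc K) f := by
    intro N f hf
    have := eval₂_reflect_mul_pow (algebraMap K (RatFunc K)) RatFunc.X N f hf
    rw [invOf_eq_inv] at this
    rw [aeval_def, this, ← aeval_def, RatFunc.aeval_X_left_eq_algebraMap]
  have hinj : Function.Injective (aeval ((RatFunc.X : RatFunc K)⁻¹) : K[X] →ₐ[K] RatFunc K) := by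
    rw [injective_iff_map_eq_zero]
    intro f hf
    have := key f.natDegree (reflect f.natDegree f) (natDegree_reflect_le.trans (by simp))
    rw [reflect_reflect, hf, zero_mul, eq_comm, map_eq_zero_iff _ (RatFunc.algebraMap_injective K)] at this
    simpa using this
  refine ⟨hinj, fun f => ?_⟩
  obtain ⟨g, h, hh, rfl⟩ := IsFractionRing.div_surjective (A := K[X]) f
  have hh0 : h ≠ 0 := nonZeroDivisors.ne_zero hh
  set N := max g.natDegree h.natDegree
  refine ⟨reflect N g, reflect N h, by simpa using hh0, ?_⟩
  rw [← key N g (le_max_left _ _), ← key N h (le_max_right _ _)]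
  have : aeval ((RatFunc.X : RatFunc K)⁻¹) (reflect N h) ≠ 0 := by
    rw [Ne, map_eq_zero_iff _ hinj]; simpa using hh0
  rw [mul_div_mul_right _ _ (pow_ne_zero _ hX), div_mul_cancel₀ _ this]

theorem transfer {K : Type*} [Field K] (g h : K[X]) (hh : h.eval 0 ≠ 0) (f : RatFunc K)
    (hf : f * aeval ((RatFunc.X : RatFunc K)⁻¹) h = aeval ((RatFunc.X : RatFunc K)⁻¹) g) :
    ∃ g' h' : K[X], h' ≠ 0 ∧ f = algebraMap K[X] (RatFunc K) g' / algebraMap K[X] (RatFunc K) h' ∧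
      g'.degree ≤ h'.degree ∧ g.eval 0 / h.eval 0 = g'.coeff h'.natDegree / h'.leadingCoeff := by
  have hX : (RatFunc.X : RatFunc K) ≠ 0 := RatFunc.X_ne_zero
  let : Invertible (RatFunc.X : RatFunc K) := invertibleOfNonzero hX
  have key : ∀ (N : ℕ) (f : K[X]), f.natDegree ≤ N →
      aeval ((RatFunc.X : RatFunc K)⁻¹) f * RatFunc.X ^ N = algebraMap K[X] (RatFunc K) (reflect N f) := by
    intro N f hf
    have := eval₂_reflect_mul_pow (algebraMap K (RatFunc K)) RatFunc.X N (reflect N f)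
      (natDegree_reflect_le.trans (by simp [hf]))
    rw [invOf_eq_inv, reflect_reflect] at this
    rw [aeval_def, this, ← aeval_def, RatFunc.aeval_X_left_eq_algebraMap]
  set N := max g.natDegree h.natDegree
  have hgN : g.natDegree ≤ N := le_max_left _ _
  have hhN : h.natDegree ≤ N := le_max_right _ _
  have hh0 : h ≠ 0 := by rintro rfl; simp at hh
  have c1 : ∀ p : K[X], (reflect N p).coeff N = p.eval 0 := by
    intro p; rw [coeff_reflect, revAt_le le_rfl, Nat.sub_self, coeff_zero_eq_eval_zero]
  have hdeg : (reflect N h).natDegree = N := by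
    apply le_antisymm (natDegree_reflect_le.trans (by simp [hhN]))
    exact le_natDegree_of_ne_zero (by rwa [c1])
  have hne : reflect N h ≠ 0 := by simpa using hh0
  refine ⟨reflect N g, reflect N h, hne, ?_, ?_, ?_⟩
  · rw [eq_div_iff (by rwa [Ne, map_eq_zero_iff _ (RatFunc.algebraMap_injective K)]), ← key N h hhN,
      ← key N g hgN, ← hf]; ring
  · rw [degree_eq_natDegree hne, hdeg]
    exact degree_le_of_natDegree_le (natDegree_reflect_le.trans (by simp [hgN]))
  · rw [leadingCoeff, hdeg, c1, c1]

theorem core_hom {K F L : Type*} [Field K] [CharZero K] [Field F] [Field L] [Algebra K F]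
    [Algebra F L] [Algebra K L] [IsScalarTower K F L] [FiniteDimensional F L]
    (φ : K[X] →ₐ[K] F) (hinj : Function.Injective φ)
    (hfr : ∀ f : F, ∃ g h : K[X], h ≠ 0 ∧ f * φ h = φ g) {n : ℕ} (b : Fin n → L)
    (hli : LinearIndependent F b)
    (hint : ∀ z, (∃ c : Fin n → K[X], z = ∑ i, algebraMap F L (φ (c i)) * b i) ↔
      ((algebraMap F L).comp φ.toRingHom).IsIntegralElem z)
    (θ : Derivation K L L) (hθ : θ (algebraMap F L (φ X)) = algebraMap F L (φ X))
    (N : Matrix (Fin n) (Fin n) F) (hN : ∀ j, θ (b j) = ∑ i, algebraMap F L (N i j) * b i) :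
    ∃ M : Matrix (Fin n) (Fin n) K,
      (∀ i j, ∃ g h : K[X], h.eval 0 ≠ 0 ∧ N i j * φ h = φ g ∧
        M i j = g.eval 0 / h.eval 0) ∧
      ∃ E : ℕ, 1 ≤ E ∧ aeval M (∏ J ∈ Finset.range E, (X - C ((J : K) / (E : K)))) = 0 := by
  let i1 : Algebra K[X] F := φ.toRingHom.toAlgebra
  let i2 : Algebra K[X] L := ((algebraMap F L).comp φ.toRingHom).toAlgebra
  have : IsScalarTower K[X] F L := IsScalarTower.of_algebraMap_eq fun _ => rfl
  have : IsScalarTower K K[X] L := IsScalarTower.of_algebraMap_eq fun a => by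
    rw [IsScalarTower.algebraMap_apply K F L]
    exact congrArg (algebraMap F L) (φ.commutes a).symm
  have hφ : ∀ p, algebraMap K[X] F p = φ p := fun _ => rfl
  have : IsFractionRing K[X] F := by
    have : FaithfulSMul K[X] F := (faithfulSMul_iff_algebraMap_injective K[X] F).mpr hinj
    refine IsFractionRing.of_field K[X] F fun f => ?_
    obtain ⟨g, h, hh, hf⟩ := hfr f
    refine ⟨g, h, ?_⟩
    have : algebraMap K[X] F h ≠ 0 := by
      rw [hφ, Ne, map_eq_zero_iff _ hinj]; exact hh
    rw [eq_div_iff this]; exact hf.symm ▸ rfl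
  exact core_alg (F := F) b hli hint θ hθ N hN

theorem root_of_aeval {K : Type*} [Field K] [CharZero K] {n : ℕ} (M : Matrix (Fin n) (Fin n) K)
    (E : ℕ) (hE : 1 ≤ E) (hM : aeval M (∏ J ∈ Finset.range E, (X - C ((J : K) / (E : K)))) = 0)
    (μ : AlgebraicClosure K)
    (hμ : (Matrix.charpoly (M.map (algebraMap K (AlgebraicClosure K)))).IsRoot μ) :
    ∃ a : ℚ, 0 ≤ a ∧ a < 1 ∧ μ = (a : AlgebraicClosure K) := by
  set p : K[X] := ∏ J ∈ Finset.range E, (X - C ((J : K) / (E : K))) with hp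
  have h1 : aeval (M.map (algebraMap K (AlgebraicClosure K))) p = 0 := by
    have := aeval_algHom_apply ((Algebra.ofId K (AlgebraicClosure K)).mapMatrix (m := Fin n)) M p
    rw [hM, map_zero] at this
    exact this
  have h2 : aeval (M.map (algebraMap K (AlgebraicClosure K)))
      (p.map (algebraMap K (AlgebraicClosure K))) = 0 := by
    rw [aeval_map_algebraMap, h1]
  have h3 := Matrix.mem_spectrum_of_isRoot_charpoly hμ
  have h4 := spectrum.subset_polynomial_aeval (M.map (algebraMap K (AlgebraicClosure K)))
      (p.map (algebraMap K (AlgebraicClosure K))) ⟨μ, h3, rfl⟩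
  have hnt : Nontrivial (Matrix (Fin n) (Fin n) (AlgebraicClosure K)) := by
    by_contra hcon
    rw [not_nontrivial_iff_subsingleton] at hcon
    rw [spectrum.of_subsingleton] at h3
    exact h3
  rw [h2, spectrum.zero_eq] at h4
  have h5 : eval μ (p.map (algebraMap K (AlgebraicClosure K))) = 0 := h4
  rw [hp, Polynomial.map_prod, eval_prod, Finset.prod_eq_zero_iff] at h5
  obtain ⟨J, hJ, h6⟩ := h5
  have hE0 : (0 : ℚ) < E := by exact_mod_cast hE
  refine ⟨(J : ℚ) / E, by positivity, ?_, ?_⟩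
  · rw [div_lt_one hE0]; exact_mod_cast Finset.mem_range.mp hJ
  · simp only [Polynomial.map_sub, map_X, map_C, eval_sub, eval_X, eval_C, map_div₀, map_natCast] at h6
    push_cast
    exact sub_eq_zero.mp h6


/-- **The exponents of `G^∞ dx` at `x = ∞` are rational numbers in `[0,1)`**
(Proposition 2.7 of the paper, part at infinity).  Setup: `K` a field of characteristic
zero, `Q ∈ K[x][y]` monic in `y` of degree `d_x ≥ 1` and irreducible over `K(x)`,
`L = K(x)[y]/(Q)` (presented as a field `L` with a generating root `y` of `Q`),
`b^∞ = (b 0, …, b (d_x - 1))` an integral basis for `L` over `K[1/x]`, and `G^∞ = G` the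
matrix over `K(x)` with `d (b j) = ∑ i, G i j • b i • dx` in `Ω¹_{L/K}`.  Then the
residue matrix of `G dx` at `x = ∞`, namely `G^∞_{-1} = -(x·G)|_{x=∞} ∈ M_{d_x}(K)`,
is well defined (each entry of `x·G` is regular at infinity: writing `x · G i j = g/h`
one may take `deg g ≤ deg h`, the value at infinity being the quotient of the coefficient
of `x^(deg h)` in `g` by the leading coefficient of `h`), and every eigenvalue of
`G^∞_{-1}` in an algebraic closure `K̄` of `K` is a rational number in `[0,1)`. -/
theorem exponents_at_infinity_rational_in_unit_interval {K L : Type*} [Field K]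
    [CharZero K]
    [Field L] [Algebra (RatFunc K) L] [Algebra K L] [IsScalarTower K (RatFunc K) L]
    (dx : ℕ) (hdx : 1 ≤ dx)
    (Q : Polynomial (Polynomial K)) (hQM : Q.Monic) (hQdeg : Q.natDegree = dx)
    (hQirr : Irreducible (Q.map (algebraMap (Polynomial K) (RatFunc K))))
    (y : L) (hy : Polynomial.aeval y (Q.map (algebraMap (Polynomial K) (RatFunc K))) = 0)
    (hgen : Algebra.adjoin (RatFunc K) {y} = ⊤)
    (b : Fin dx → L)
    (hb_li : LinearIndependent (RatFunc K) b)
    (hb_span : Submodule.span (RatFunc K) (Set.range b) = ⊤)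
    (hb_int : ∀ z : L,
      (∃ c : Fin dx → Polynomial K,
          z = ∑ i, algebraMap (RatFunc K) L
            (Polynomial.aeval ((RatFunc.X : RatFunc K)⁻¹) (c i)) * b i)
        ↔ ((algebraMap (RatFunc K) L).comp
            (Polynomial.aeval ((RatFunc.X : RatFunc K)⁻¹) :
              Polynomial K →ₐ[K] RatFunc K).toRingHom).IsIntegralElem z)
    (G : Matrix (Fin dx) (Fin dx) (RatFunc K))
    (hG : ∀ j, (KaehlerDifferential.D K L) (b j) =
      ∑ i, (algebraMap (RatFunc K) L (G i j) * b i) •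
        (KaehlerDifferential.D K L) (algebraMap (RatFunc K) L RatFunc.X)) :
    ∃ M : Matrix (Fin dx) (Fin dx) K,
      (∀ i j, ∃ g h : Polynomial K, h ≠ 0 ∧
        RatFunc.X * G i j = algebraMap (Polynomial K) (RatFunc K) g /
          algebraMap (Polynomial K) (RatFunc K) h ∧
        g.degree ≤ h.degree ∧
        M i j = -(g.coeff h.natDegree / h.leadingCoeff)) ∧
      (∀ μ : AlgebraicClosure K,
        (Matrix.charpoly (M.map (algebraMap K (AlgebraicClosure K)))).IsRoot μ →
        ∃ a : ℚ, 0 ≤ a ∧ a < 1 ∧ μ = (a : AlgebraicClosure K)) := by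
  have hfd : FiniteDimensional (RatFunc K) L := Module.Finite.of_basis (Module.Basis.mk hb_li hb_span.ge)
  obtain ⟨ℓ, hℓ⟩ := exists_deriv (K := K) (L := L)
  set x : L := algebraMap (RatFunc K) L RatFunc.X with hx
  have hx0 : x ≠ 0 := by
    rw [hx, Ne, map_eq_zero_iff _ (algebraMap (RatFunc K) L).injective]; exact RatFunc.X_ne_zero
  let δ : Derivation K L L := ℓ.compDer (KaehlerDifferential.D K L)
  have hδ : ∀ z, δ z = ℓ (KaehlerDifferential.D K L z) := fun _ => rfl
  have hδx : δ x = 1 := hℓ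
  let θ : Derivation K L L := (-x) • δ
  have hθd : ∀ z, θ z = -x * δ z := fun _ => rfl
  obtain ⟨hinj, hfr⟩ := fracRing_inv (K := K)
  obtain ⟨M, hM, E, hE, hE0⟩ := core_hom (F := RatFunc K)
    (aeval ((RatFunc.X : RatFunc K)⁻¹)) hinj hfr b hb_li hb_int θ (by
      rw [aeval_X, map_inv₀, ← hx, hθd, Derivation.leibniz_inv, hδx]
      simp only [smul_eq_mul]
      field_simp) (fun i j => -(RatFunc.X * G i j)) (by
      intro j
      rw [hθd, hδ, hG, map_sum, Finset.mul_sum]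
      refine Finset.sum_congr rfl fun i _ => ?_
      rw [map_smul, hℓ, map_neg, map_mul, ← hx]
      simp only [smul_eq_mul]
      ring)
  refine ⟨M, ?_, fun μ hμ => root_of_aeval M E hE hE0 μ hμ⟩
  intro i j
  obtain ⟨g, h, hh, hgh, hMij⟩ := hM i j
  obtain ⟨g', h', hh', hf, hdeg, hval⟩ := transfer (-g) h hh (RatFunc.X * G i j) (by
    rw [map_neg, ← hgh]; ring)
  refine ⟨g', h', hh', hf, hdeg, ?_⟩
  rw [← hval, hMij, eval_neg]; ring
end
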